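/- Let Q0 be a cube in ℝ^d, 1 < p < ∞, 0 < q, r ≤ ∞, k ∈ ℕ with k > d/p, and b < −1/r. There is C > 0 such that ||f^#_{Q0}||_{L_{∞,r}(log L)_b(Q0)} ≤ C ||f||_{B^{d/p, b+1/r}_r L_{p,q}(Q0);k} for all f. In particular, ||f^#_{Q0}||_{L_{∞,r}(log L)_b(Q0)} ≤ C ||f||_{B^{d/p, b+1/r}_{p,r}(Q0);k}, and for λ > 0, ||f^#_{Q0}||_{exp L^λ(Q0)} ≤ C ||f||_{B^{d/p, −1/λ}_{p,∞}(Q0);k}. -/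

import Mathlib

open MeasureTheory ENNReal Set Filter

noncomputable section

abbrev Euc (d : ℕ) := EuclideanSpace ℝ (Fin d)

/-- Non-increasing rearrangement of an `ℝ≥0∞`-valued function w.r.t. a measure. -/
def rearr {α : Type*} [MeasurableSpace α] (μ : Measure α) (g : α → ℝ≥0∞) (t : ℝ) : ℝ≥0∞ :=
  sInf {l : ℝ≥0∞ | μ {x | l < g x} ≤ ENNReal.ofReal t}

/-- Non-increasing rearrangement of a real-valued function. -/
def rearrR {α : Type*} [MeasurableSpace α] (μ : Measure α) (f : α → ℝ) (t : ℝ) : ℝ≥0∞ :=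
  rearr μ (fun x => ENNReal.ofReal |f x|) t

/-- The maximal function `f^{**}(t) = t⁻¹ ∫_0^t f^*`. -/
def rearrStar {α : Type*} [MeasurableSpace α] (μ : Measure α) (f : α → ℝ) (t : ℝ) : ℝ≥0∞ :=
  (ENNReal.ofReal t)⁻¹ * ∫⁻ s in Set.Ioo (0:ℝ) t, rearrR μ f s

/-- `(∫_I g(t)^q dt/t)^{1/q}`, with the usual sup modification when `q = ∞`. -/
def qnorm (q : ℝ≥0∞) (I : Set ℝ) (g : ℝ → ℝ≥0∞) : ℝ≥0∞ :=
  if q = ∞ then ⨆ t ∈ I, g t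
  else (∫⁻ t in I, g t ^ q.toReal / ENNReal.ofReal t) ^ (1 / q.toReal)

/-- `∫_I g(t)^q dt/t` (no outer power), with the sup modification when `q = ∞`. -/
def qint (q : ℝ≥0∞) (I : Set ℝ) (g : ℝ → ℝ≥0∞) : ℝ≥0∞ :=
  if q = ∞ then ⨆ t ∈ I, g t
  else ∫⁻ t in I, g t ^ q.toReal / ENNReal.ofReal t

/-- Lorentz quasinorm `(∫_I (t^{1/p} f^*(t))^q dt/t)^{1/q}`. -/
def lorentz {α : Type*} [MeasurableSpace α] (μ : Measure α) (f : α → ℝ)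
    (p : ℝ) (q : ℝ≥0∞) (I : Set ℝ) : ℝ≥0∞ :=
  qnorm q I (fun t => ENNReal.ofReal (t ^ (1 / p)) * rearrR μ f t)

/-- The cube with lower-left corner `a` and side length `l`. -/
def cubeSet {d : ℕ} (a : Fin d → ℝ) (l : ℝ) : Set (Euc d) :=
  {x | ∀ i, a i ≤ x i ∧ x i ≤ a i + l}

/-- Cubes in `ℝ^d` with sides parallel to the coordinate axes. -/
def IsCube {d : ℕ} (Q : Set (Euc d)) : Prop := ∃ a l, 0 < l ∧ Q = cubeSet a l

/-- The sharp maximal function `f^{#}` on `ℝ^d`. -/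
def sharp {d : ℕ} (f : Euc d → ℝ) (x : Euc d) : ℝ≥0∞ :=
  ⨆ Q ∈ {Q : Set (Euc d) | IsCube Q ∧ x ∈ Q},
    ENNReal.ofReal (⨍ y in Q, |f y - ⨍ z in Q, f z|)

/-- The local sharp maximal function `f^{#}_{Q_0;μ}`. -/
def sharpLocal {d : ℕ} (μ : Measure (Euc d)) (Q0 : Set (Euc d)) (f : Euc d → ℝ)
    (x : Euc d) : ℝ≥0∞ :=
  ⨆ Q ∈ {Q : Set (Euc d) | IsCube Q ∧ x ∈ Q ∧ Q ⊆ Q0},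
    ENNReal.ofReal (⨍ y in Q, |f y - ⨍ z in Q, f z ∂μ| ∂μ)

def diffOp {d : ℕ} (h : Euc d) (f : Euc d → ℝ) : Euc d → ℝ := fun x => f (x + h) - f x

/-- The iterated difference `Δ_h^k f`. -/
def iterDiff {d : ℕ} (k : ℕ) (h : Euc d) (f : Euc d → ℝ) : Euc d → ℝ := (diffOp h)^[k] f

/-- The modulus of smoothness `ω_k(f,t)_{p,q}` on `ℝ^d`. -/
def modulus {d : ℕ} (k : ℕ) (f : Euc d → ℝ) (p : ℝ) (q : ℝ≥0∞) (t : ℝ) : ℝ≥0∞ :=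
  ⨆ h ∈ {h : Euc d | ‖h‖ ≤ t}, lorentz volume (iterDiff k h f) p q (Set.Ioi 0)


/-- The modulus of smoothness `ω_k(f,t)_{p,q}` on a cube `Q0`. -/
def modulusQ {d : ℕ} (Q0 : Set (Euc d)) (k : ℕ) (f : Euc d → ℝ)
    (p : ℝ) (q : ℝ≥0∞) (t : ℝ) : ℝ≥0∞ :=
  ⨆ h ∈ {h : Euc d | ‖h‖ ≤ t},
    lorentz (volume.restrict {x ∈ Q0 | x + (k : ℝ) • h ∈ Q0})
      (iterDiff k h f) p q (Set.Ioo 0 1)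

/-- The inhomogeneous logarithmic Lorentz–Besov norm `‖f‖_{B^{s,ξ}_r L_{p,q}(Q0);k}`. -/
def besovQ {d : ℕ} (Q0 : Set (Euc d)) (k : ℕ) (f : Euc d → ℝ)
    (p : ℝ) (q : ℝ≥0∞) (s ξ : ℝ) (r : ℝ≥0∞) : ℝ≥0∞ :=
  lorentz (volume.restrict Q0) f p q (Set.Ioo 0 1) +
    qnorm r (Set.Ioo 0 1)
      (fun t => ENNReal.ofReal (t ^ (-s) * (1 - Real.log t) ^ ξ) * modulusQ Q0 k f p q t)

theorem cubeSet_eq_preimage {d : ℕ} (a : Fin d → ℝ) (l : ℝ) :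
    cubeSet a l = (MeasurableEquiv.toLp 2 (Fin d → ℝ)).symm ⁻¹' (Set.Icc a (fun i => a i + l)) := by
  ext x
  simp only [cubeSet, Set.mem_ofPred_eq, Set.mem_preimage, Set.mem_Icc, Pi.le_def]
  constructor
  · intro h; exact ⟨fun i => (h i).1, fun i => (h i).2⟩
  · intro h i; exact ⟨h.1 i, h.2 i⟩

theorem measurableSet_cubeSet {d : ℕ} (a : Fin d → ℝ) (l : ℝ) : MeasurableSet (cubeSet a l) := by
  rw [cubeSet_eq_preimage]
  exact (MeasurableEquiv.toLp 2 (Fin d → ℝ)).symm.measurable measurableSet_Icc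

theorem volume_cubeSet {d : ℕ} (a : Fin d → ℝ) (l : ℝ) (hl : 0 ≤ l) :
    volume (cubeSet a l) = ENNReal.ofReal (l ^ d) := by
  rw [cubeSet_eq_preimage, (EuclideanSpace.volume_preserving_symm_measurableEquiv_toLp (Fin d)).measure_preimage
    measurableSet_Icc.nullMeasurableSet, Real.volume_Icc_pi]
  simp [ENNReal.ofReal_pow hl]

theorem cube_combo {d : ℕ} {a : Fin d → ℝ} {l : ℝ} {x y : Euc d} (hx : x ∈ cubeSet a l)
    (hy : y ∈ cubeSet a l) {e : ℝ} (he : 0 ≤ e) (he1 : e ≤ 1) :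
    x + e • (y - x) ∈ cubeSet a l := by
  intro i
  have h1 := hx i
  have h2 := hy i
  simp only [PiLp.add_apply, PiLp.smul_apply, PiLp.sub_apply, smul_eq_mul]
  constructor <;> nlinarith

/-- subcube -/
def subc {d : ℕ} (a : Fin d → ℝ) (e : ℝ) (x : Euc d) : Fin d → ℝ := fun i => x i + e * (a i - x i)

theorem mem_subc {d : ℕ} {a : Fin d → ℝ} {l : ℝ} {x y : Euc d} {e : ℝ} (he : 0 < e) :
    x + e • (y - x) ∈ cubeSet (subc a e x) (e * l) ↔ y ∈ cubeSet a l := by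
  simp only [cubeSet, subc, Set.mem_ofPred_eq, PiLp.add_apply, PiLp.smul_apply, PiLp.sub_apply, smul_eq_mul]
  refine forall_congr' fun i => ?_
  constructor
  · rintro ⟨h1, h2⟩
    constructor
    · by_contra h; push Not at h; nlinarith
    · by_contra h; push Not at h; nlinarith
  · rintro ⟨h1, h2⟩
    constructor <;> nlinarith

theorem subc_subset {d : ℕ} {a : Fin d → ℝ} {l : ℝ} {x : Euc d} {e : ℝ} (he : 0 < e) (he1 : e ≤ 1)
    (hx : x ∈ cubeSet a l) :
    cubeSet (subc a e x) (e * l) ⊆ cubeSet a l := by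
  intro y hy i
  have h1 := hx i
  have h2 := hy i
  simp only [subc] at h2
  constructor <;> nlinarith

theorem cube_norm_le {d : ℕ} {a : Fin d → ℝ} {l : ℝ} {x y : Euc d} (hx : x ∈ cubeSet a l)
    (hy : y ∈ cubeSet a l) : ‖y - x‖ ≤ d * l := by
  rcases Nat.eq_zero_or_pos d with rfl | hd
  · rw [Subsingleton.elim (y - x) 0]; simp
  have hl : 0 ≤ l := by have := hx ⟨0, hd⟩; linarith
  rw [EuclideanSpace.norm_eq]
  apply Real.sqrt_le_iff.mpr
  refine ⟨by positivity, ?_⟩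
  calc ∑ i, ‖(y - x) i‖ ^ 2 ≤ ∑ i : Fin d, l ^ 2 := by
        apply Finset.sum_le_sum
        intro i _
        have h1 := hx i
        have h2 := hy i
        simp only [PiLp.sub_apply, Real.norm_eq_abs, sq_abs]
        apply sq_le_sq'  <;> linarith
    _ = d * l ^ 2 := by simp
    _ ≤ (d * l) ^ 2 := by
        have : (1:ℝ) ≤ d := by exact_mod_cast hd
        have h3 : (0:ℝ) ≤ l ^ 2 := by positivity
        nlinarith [mul_nonneg (mul_nonneg (by linarith : (0:ℝ) ≤ d) (by linarith : (0:ℝ) ≤ (d:ℝ) - 1)) h3]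

/-- averages of `g` over subcubes -/
def Bop {d : ℕ} (a : Fin d → ℝ) (l : ℝ) (e : ℝ) (g : Euc d → ℝ) (x : Euc d) : ℝ :=
  (l ^ d)⁻¹ * ∫ y in cubeSet a l, g (x + e • (y - x))

theorem comp_indicator {d : ℕ} {a : Fin d → ℝ} {l : ℝ} {x : Euc d} {e : ℝ} (he : 0 < e)
    (g : Euc d → ℝ) :
    (cubeSet a l).indicator (fun y => g (x + e • (y - x))) =
      fun y => (fun z => (cubeSet (subc a e x) (e * l)).indicator g ((x - e • x) + z)) (e • y) := by
  funext y
  have h : (x - e • x) + e • y = x + e • (y - x) := by rw [smul_sub]; abel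
  simp only [h]
  by_cases hy : y ∈ cubeSet a l
  · rw [Set.indicator_of_mem hy, Set.indicator_of_mem ((mem_subc he).2 hy)]
  · rw [Set.indicator_of_notMem hy, Set.indicator_of_notMem (fun h => hy ((mem_subc he).1 h))]

theorem comp_integrable {d : ℕ} {a : Fin d → ℝ} {l : ℝ} {x : Euc d} {e : ℝ} (he : 0 < e)
    (he1 : e ≤ 1) (hx : x ∈ cubeSet a l)
    {g : Euc d → ℝ} (hg : IntegrableOn g (cubeSet a l)) :
    IntegrableOn (fun y => g (x + e • (y - x))) (cubeSet a l) := by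
  rw [← integrable_indicator_iff (measurableSet_cubeSet a l), comp_indicator he]
  refine (integrable_comp_smul_iff volume
    (fun z => (cubeSet (subc a e x) (e * l)).indicator g ((x - e • x) + z)) he.ne').2 ?_
  apply Integrable.comp_add_left
  rw [integrable_indicator_iff (measurableSet_cubeSet _ _)]
  exact hg.mono_set (subc_subset he he1 hx)

theorem Bop_eq {d : ℕ} {a : Fin d → ℝ} {l : ℝ} {x : Euc d} {e : ℝ} (he : 0 < e)
    (g : Euc d → ℝ) :
    Bop a l e g x = ((e * l) ^ d)⁻¹ * ∫ y in cubeSet (subc a e x) (e * l), g y := by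
  unfold Bop
  rw [← integral_indicator (measurableSet_cubeSet a l), comp_indicator he,
    Measure.integral_comp_smul volume
      (fun z => (cubeSet (subc a e x) (e * l)).indicator g ((x - e • x) + z)) e,
    integral_add_left_eq_self, integral_indicator (measurableSet_cubeSet _ _)]
  simp only [finrank_euclideanSpace, Fintype.card_fin, smul_eq_mul]
  rw [abs_of_pos (by positivity), mul_pow, mul_inv]
  ring

theorem Bop_measurable {d : ℕ} (a : Fin d → ℝ) (l e : ℝ) {g : Euc d → ℝ} (hg : Measurable g) :
    Measurable (Bop a l e g) := by
  unfold Bop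
  apply Measurable.const_mul
  have : StronglyMeasurable (fun p : Euc d × Euc d => g (p.1 + e • (p.2 - p.1))) := by
    apply Measurable.stronglyMeasurable
    fun_prop
  exact (this.integral_prod_right' (ν := volume.restrict (cubeSet a l))).measurable

theorem Bop_zero {d : ℕ} (a : Fin d → ℝ) {l : ℝ} (hl : 0 < l) (g : Euc d → ℝ) (x : Euc d) :
    Bop a l 0 g x = g x := by
  unfold Bop
  simp only [zero_smul, add_zero, setIntegral_const, smul_eq_mul, Measure.real,
    volume_cubeSet a l hl.le]
  rw [ENNReal.toReal_ofReal (by positivity)]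
  field_simp

/-- the approximation operator -/
def Tap {d : ℕ} (a : Fin d → ℝ) (l : ℝ) (k : ℕ) (δ : ℝ) (f : Euc d → ℝ) (x : Euc d) : ℝ :=
  ∑ j ∈ Finset.range k, ((-1) ^ j * (k.choose (j+1) : ℝ)) * Bop a l (((j + 1 : ℕ) : ℝ) * δ) f x

theorem Tap_measurable {d : ℕ} (a : Fin d → ℝ) (l : ℝ) (k : ℕ) (δ : ℝ) {f : Euc d → ℝ}
    (hf : Measurable f) : Measurable (Tap a l k δ f) := by
  unfold Tap
  apply Finset.measurable_fun_sum
  intro j _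
  exact (Bop_measurable a l _ hf).const_mul _

theorem iterDiff_eq {d : ℕ} (k : ℕ) (h : Euc d) (f : Euc d → ℝ) (x : Euc d) :
    iterDiff k h f x = ∑ j ∈ Finset.range (k + 1),
      ((-1) ^ (k - j) * (k.choose j : ℝ)) * f (x + (j : ℝ) • h) := by
  have := fwdDiff_iter_eq_sum_shift h f k x
  have e : iterDiff k h f x = (fwdDiff h)^[k] f x := rfl
  rw [e, this]
  apply Finset.sum_congr rfl
  intro j _
  rw [zsmul_eq_mul, Nat.cast_smul_eq_nsmul]
  push_cast
  ring

theorem sub_Tap_eq {d : ℕ} (a : Fin d → ℝ) {l : ℝ} (hl : 0 < l) (k : ℕ) {δ : ℝ} (hδ : 0 < δ)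
    (hkδ : k * δ ≤ 1) {f : Euc d → ℝ} (hf : IntegrableOn f (cubeSet a l)) {x : Euc d}
    (hx : x ∈ cubeSet a l) :
    f x - Tap a l k δ f x = (-1) ^ k * ((l ^ d)⁻¹ *
      ∫ y in cubeSet a l, iterDiff k (δ • (y - x)) f x) := by
  have h1 : f x - Tap a l k δ f x = ∑ j ∈ Finset.range (k + 1),
      ((-1) ^ j * (k.choose j : ℝ)) * Bop a l ((j : ℝ) * δ) f x := by
    rw [Finset.sum_range_succ']
    simp only [Nat.cast_zero, zero_mul, Bop_zero a hl, Tap, pow_zero, Nat.choose_zero_right,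
      Nat.cast_one, one_mul]
    rw [add_comm, sub_eq_add_neg, ← Finset.sum_neg_distrib]
    congr 1
    apply Finset.sum_congr rfl
    intro j _
    rw [pow_succ]; ring
  rw [h1]
  simp only [iterDiff_eq]
  rw [integral_finsetSum]
  · rw [Finset.mul_sum, Finset.mul_sum]
    apply Finset.sum_congr rfl
    intro j hj
    rw [integral_const_mul]
    unfold Bop
    have : ((-1 : ℝ)) ^ k = (-1) ^ (k - j) * (-1) ^ j := by
      rw [← pow_add]; congr 1
      have := Finset.mem_range.1 hj; omega
    rw [this]
    have h2 : ((-1 : ℝ)) ^ (k - j) * (-1) ^ (k - j) = 1 := by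
      rw [← mul_pow]; norm_num
    simp only [smul_smul]
    linear_combination (-(-1) ^ j * (k.choose j : ℝ) *
      ((l ^ d)⁻¹ * ∫ y in cubeSet a l, f (x + ((j : ℝ) * δ) • (y - x)))) * h2
  · intro j hj
    apply Integrable.const_mul
    simp only [smul_smul]
    rcases Nat.eq_zero_or_pos j with rfl | hj0
    · simp only [Nat.cast_zero, zero_mul, zero_smul, add_zero]
      apply integrableOn_const
      · rw [volume_cubeSet a l hl.le]; simp
      · simp
    · have hj0' : (0:ℝ) < j := by exact_mod_cast hj0
      have hjk : (j:ℝ) ≤ k := by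
        have := Finset.mem_range.1 hj
        exact_mod_cast (by omega : j ≤ k)
      exact comp_integrable (by positivity) (by nlinarith) hx hf

theorem enorm_sub_Tap_le {d : ℕ} (a : Fin d → ℝ) {l : ℝ} (hl : 0 < l) (k : ℕ) {δ : ℝ} (hδ : 0 < δ)
    (hkδ : k * δ ≤ 1) {f : Euc d → ℝ} (hf : IntegrableOn f (cubeSet a l)) {x : Euc d}
    (hx : x ∈ cubeSet a l) :
    ‖f x - Tap a l k δ f x‖ₑ ≤ ENNReal.ofReal ((l ^ d)⁻¹) *
      ∫⁻ y in cubeSet a l, ‖iterDiff k (δ • (y - x)) f x‖ₑ := by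
  rw [sub_Tap_eq a hl k hδ hkδ hf hx, enorm_mul, enorm_mul]
  have h1 : ‖((-1:ℝ)) ^ k‖ₑ = 1 := by
    rw [enorm_pow]; simp
  rw [h1, one_mul]
  have h2 : ‖(l ^ d)⁻¹‖ₑ = ENNReal.ofReal ((l ^ d)⁻¹) := by
    rw [← ofReal_norm, Real.norm_of_nonneg (by positivity)]
  rw [h2]
  gcongr
  exact enorm_integral_le_lintegral_enorm _

theorem measurable_iterDiff2 {d : ℕ} (k : ℕ) (δ : ℝ) {f : Euc d → ℝ} (hf : Measurable f) :
    Measurable (fun p : Euc d × Euc d => iterDiff k (δ • p.2) f p.1) := by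
  simp only [iterDiff_eq]
  fun_prop

theorem approx_bound {d : ℕ} (a : Fin d → ℝ) {l : ℝ} (hl : 0 < l) (k : ℕ) {δ : ℝ} (hδ : 0 < δ)
    (hkδ : k * δ ≤ 1) {f : Euc d → ℝ} (hfm : Measurable f) (hf : IntegrableOn f (cubeSet a l))
    {D : ℝ} (hD : d * l ≤ D) {W α : ℝ} (hα : 0 ≤ α)
    (hW : ∀ h : Euc d, ‖h‖ ≤ D * δ → ∀ A : Set (Euc d), MeasurableSet A →
      A ⊆ {x ∈ cubeSet a l | x + (k : ℝ) • h ∈ cubeSet a l} →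
      ∫⁻ x in A, ‖iterDiff k h f x‖ₑ ≤ ENNReal.ofReal W * volume A ^ α)
    (E : Set (Euc d)) (hE : MeasurableSet E) (hEQ : E ⊆ cubeSet a l) :
    ∫⁻ x in E, ‖f x - Tap a l k δ f x‖ₑ ≤ ENNReal.ofReal (2 ^ d * W) * volume E ^ α := by
  have hQ := measurableSet_cubeSet a l
  set G : Euc d × Euc d → ℝ≥0∞ := fun p =>
    (E ×ˢ (univ : Set (Euc d)) ∩ {p : Euc d × Euc d | p.1 + p.2 ∈ cubeSet a l}).indicator
      (fun p => ‖iterDiff k (δ • p.2) f p.1‖ₑ) p with hG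
  have hGm : Measurable G := by
    apply Measurable.indicator
    · exact (measurable_iterDiff2 k δ hfm).enorm
    · apply (hE.prod MeasurableSet.univ).inter
      exact (by fun_prop : Measurable (fun p : Euc d × Euc d => p.1 + p.2)) hQ
  have step1 : ∫⁻ x in E, ‖f x - Tap a l k δ f x‖ₑ ≤
      ∫⁻ x in E, ENNReal.ofReal ((l ^ d)⁻¹) * ∫⁻ z, G (x, z) := by
    apply setLIntegral_mono' hE
    intro x hx
    refine (enorm_sub_Tap_le a hl k hδ hkδ hf (hEQ hx)).trans ?_
    refine mul_le_mul' le_rfl ?_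
    rw [← lintegral_indicator hQ, ← lintegral_add_left_eq_self _ x]
    apply le_of_eq
    congr 1
    funext z
    have hiff : (x, z) ∈ E ×ˢ (univ : Set (Euc d)) ∩ {p : Euc d × Euc d | p.1 + p.2 ∈ cubeSet a l} ↔
        x + z ∈ cubeSet a l := by simp [hx]
    simp only [hG]
    by_cases h : x + z ∈ cubeSet a l
    · rw [Set.indicator_of_mem h, Set.indicator_of_mem (hiff.2 h)]; simp
    · rw [Set.indicator_of_notMem h, Set.indicator_of_notMem (fun h' => h (hiff.1 h'))]
  have step2 : ∫⁻ x in E, ENNReal.ofReal ((l ^ d)⁻¹) * ∫⁻ z, G (x, z) ≤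
      ENNReal.ofReal ((l ^ d)⁻¹) * ∫⁻ z, ∫⁻ x, G (x, z) := by
    refine (setLIntegral_le_lintegral _ _).trans ?_
    rw [lintegral_const_mul _ hGm.lintegral_prod_right', lintegral_lintegral_swap hGm.aemeasurable]
  have step3 : ∀ z, ∫⁻ x, G (x, z) ≤ (cubeSet (d := d) (fun _ => -l) (2 * l)).indicator
      (fun _ => ENNReal.ofReal W * volume E ^ α) z := by
    intro z
    set A := E ∩ {x | x + z ∈ cubeSet a l} with hA
    have hAm : MeasurableSet A :=
      hE.inter ((by fun_prop : Measurable (fun p : Euc d => p + z)) hQ)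
    have e1 : ∫⁻ x, G (x, z) = ∫⁻ x in A, ‖iterDiff k (δ • z) f x‖ₑ := by
      rw [← lintegral_indicator hAm]
      congr 1
      funext x
      have hiff : (x, z) ∈ E ×ˢ (univ : Set (Euc d)) ∩
          {p : Euc d × Euc d | p.1 + p.2 ∈ cubeSet a l} ↔ x ∈ A := by simp [hA]
      simp only [hG]
      by_cases h : x ∈ A
      · rw [Set.indicator_of_mem h, Set.indicator_of_mem (hiff.2 h)]
      · rw [Set.indicator_of_notMem h, Set.indicator_of_notMem (fun h' => h (hiff.1 h'))]
    rw [e1]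
    rcases A.eq_empty_or_nonempty with h0 | ⟨x0, hx0⟩
    · rw [h0]; simp
    · have hz : ‖z‖ ≤ d * l := by
        have := cube_norm_le (hEQ hx0.1) hx0.2
        simpa using this
      have hz2 : z ∈ cubeSet (d := d) (fun _ => -l) (2 * l) := by
        intro i
        have h1 := hEQ hx0.1 i
        have h2 := hx0.2 i
        simp only [PiLp.add_apply] at h2
        constructor <;> linarith
      rw [Set.indicator_of_mem hz2]
      refine (hW (δ • z) ?_ A hAm ?_).trans ?_
      · rw [norm_smul, Real.norm_of_nonneg hδ.le]
        nlinarith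
      · intro x hx
        refine ⟨hEQ hx.1, ?_⟩
        have := cube_combo (hEQ hx.1) hx.2 (e := k * δ) (by positivity) hkδ
        simpa [smul_smul] using this
      · gcongr
        exact Set.inter_subset_left
  refine (step1.trans step2).trans ?_
  calc ENNReal.ofReal ((l ^ d)⁻¹) * ∫⁻ z, ∫⁻ x, G (x, z)
      ≤ ENNReal.ofReal ((l ^ d)⁻¹) * ∫⁻ z, (cubeSet (d := d) (fun _ => -l) (2 * l)).indicator
          (fun _ => ENNReal.ofReal W * volume E ^ α) z := by gcongr; exact step3 _
    _ = ENNReal.ofReal ((l ^ d)⁻¹) * (ENNReal.ofReal W * volume E ^ α * ENNReal.ofReal ((2 * l) ^ d)) := by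
        rw [lintegral_indicator (measurableSet_cubeSet _ _), setLIntegral_const,
          volume_cubeSet _ _ (by positivity)]
    _ = ENNReal.ofReal ((l ^ d)⁻¹) * ENNReal.ofReal ((2 * l) ^ d) * ENNReal.ofReal W * volume E ^ α := by ring
    _ = _ := by
        rw [← ENNReal.ofReal_mul (by positivity), ← ENNReal.ofReal_mul (by positivity)]
        congr 2
        rw [mul_pow]
        field_simp

/-- two cubes -/
theorem cube_diff_volume {d : ℕ} (a a' : Fin d → ℝ) {s u : ℝ} (hs : 0 < s) (hu : 0 ≤ u)
    (h : ∀ i, |a i - a' i| ≤ u) :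
    volume (cubeSet a s \ cubeSet a' s) ≤ ENNReal.ofReal (d * (u / s) * s ^ d) := by
  rcases lt_or_ge s u with hsu | hus
  · rcases Nat.eq_zero_or_pos d with rfl | hd
    · have : cubeSet a s \ cubeSet a' s = ∅ := by
        ext x; simp [cubeSet]
      rw [this]; simp
    refine (measure_mono sdiff_subset).trans ?_
    rw [volume_cubeSet a s hs.le]
    apply ENNReal.ofReal_le_ofReal
    have h1 : (1:ℝ) ≤ d := by exact_mod_cast hd
    have h2 : 1 ≤ u / s := by rw [one_le_div hs]; exact hsu.le
    have h3 : 0 < s ^ d := by positivity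
    have h4 : (1:ℝ) ≤ d * (u / s) := by nlinarith
    nlinarith
  · set I := cubeSet (d := d) (fun i => max (a i) (a' i)) (s - u) with hI
    have hIsub : cubeSet a s \ cubeSet a' s ⊆ cubeSet a s \ I := by
      intro x hx
      refine ⟨hx.1, fun hxI => hx.2 fun i => ?_⟩
      have h1 := hxI i
      have h2 := abs_le.1 (h i)
      constructor
      · exact (le_max_right _ _).trans h1.1
      · have : max (a i) (a' i) ≤ a' i + u := max_le (by linarith) (by linarith)
        linarith [h1.2]
    have hIa : I ⊆ cubeSet a s := by
      intro x hxI i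
      have h1 := hxI i
      have h2 := abs_le.1 (h i)
      constructor
      · exact (le_max_left _ _).trans h1.1
      · have : max (a i) (a' i) ≤ a i + u := max_le (by linarith) (by linarith)
        linarith [h1.2]
    refine (measure_mono hIsub).trans ?_
    rw [measure_sdiff hIa (measurableSet_cubeSet _ _).nullMeasurableSet
      (by rw [hI, volume_cubeSet _ _ (by linarith)]; simp), volume_cubeSet a s hs.le, hI,
      volume_cubeSet _ _ (by linarith), ← ENNReal.ofReal_sub _ (by
        have : 0 ≤ s - u := by linarith
        positivity)]
    apply ENNReal.ofReal_le_ofReal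
    have hb := one_add_mul_le_pow (a := -(u / s)) (by
      have : u / s ≤ 1 := by rw [div_le_one hs]; exact hus
      linarith) d
    have e : (s - u) ^ d = (1 + -(u/s)) ^ d * s ^ d := by
      rw [← mul_pow]; congr 1; field_simp; ring
    rw [e]
    have h3 : 0 < s ^ d := by positivity
    nlinarith

theorem setIntegral_diff_le {X : Type*} [MeasurableSpace X] {μ : Measure X} {g : X → ℝ}
    {S S' : Set X} (hS : MeasurableSet S) (hS' : MeasurableSet S')
    (h1 : IntegrableOn g S μ) (h2 : IntegrableOn g S' μ) {c : ℝ} (hc : 0 ≤ c)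
    (hd1 : ∫⁻ x in S \ S', ‖g x‖ₑ ∂μ ≤ ENNReal.ofReal c)
    (hd2 : ∫⁻ x in S' \ S, ‖g x‖ₑ ∂μ ≤ ENNReal.ofReal c) :
    |(∫ x in S, g x ∂μ) - ∫ x in S', g x ∂μ| ≤ 2 * c := by
  have e1 := integral_inter_add_sdiff hS' h1
  have e2 := integral_inter_add_sdiff hS h2
  rw [Set.inter_comm] at e2
  have key : ∀ T : Set X, ∫⁻ x in T, ‖g x‖ₑ ∂μ ≤ ENNReal.ofReal c → |∫ x in T, g x ∂μ| ≤ c := by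
    intro T hT
    have := (enorm_integral_le_lintegral_enorm (μ := μ.restrict T) g).trans hT
    rw [← ofReal_norm, ENNReal.ofReal_le_ofReal_iff hc] at this
    exact this
  have k1 := abs_le.1 (key _ hd1)
  have k2 := abs_le.1 (key _ hd2)
  rw [← e1, ← e2, abs_le]
  constructor <;> linarith

theorem Bop_holder {d : ℕ} {a : Fin d → ℝ} {l : ℝ} (hl : 0 < l) {g : Euc d → ℝ}
    (hg : IntegrableOn g (cubeSet a l)) {B α : ℝ} (hB : 0 ≤ B) (hα : 0 ≤ α)
    (hbd : ∀ E : Set (Euc d), MeasurableSet E → E ⊆ cubeSet a l →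
      ∫⁻ x in E, ‖g x‖ₑ ≤ ENNReal.ofReal B * volume E ^ α)
    {e : ℝ} (he : 0 < e) (he1 : e ≤ 1) {x x' : Euc d} (hx : x ∈ cubeSet a l)
    (hx' : x' ∈ cubeSet a l) {u : ℝ} (hu : 0 ≤ u) (hxx : ∀ i, |x i - x' i| ≤ u) :
    |Bop a l e g x - Bop a l e g x'| ≤
      2 * B * (d * (u / (e * l))) ^ α * ((e * l) ^ d) ^ (α - 1) := by
  rw [Bop_eq he, Bop_eq he]
  set s := e * l with hs
  have hs0 : 0 < s := by positivity
  have hsd : 0 < s ^ d := by positivity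
  have hsub := subc_subset (l := l) he he1 hx
  have hsub' := subc_subset (l := l) he he1 hx'
  have hdist : ∀ i, |subc a e x i - subc a e x' i| ≤ u := by
    intro i
    have : subc a e x i - subc a e x' i = (1 - e) * (x i - x' i) := by simp only [subc]; ring
    rw [this, abs_mul, abs_of_nonneg (by linarith)]
    have := hxx i
    have h0 := abs_nonneg (x i - x' i)
    nlinarith
  have hdist' : ∀ i, |subc a e x' i - subc a e x i| ≤ u := by
    intro i; rw [abs_sub_comm]; exact hdist i
  have hv : ∀ E : Set (Euc d), MeasurableSet E → E ⊆ cubeSet a l →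
      volume E ≤ ENNReal.ofReal (d * (u / s) * s ^ d) →
      ∫⁻ x in E, ‖g x‖ₑ ≤ ENNReal.ofReal (B * (d * (u / s) * s ^ d) ^ α) := by
    intro E hE hEQ hEv
    refine (hbd E hE hEQ).trans ?_
    rw [ENNReal.ofReal_mul hB, ← ENNReal.ofReal_rpow_of_nonneg (by positivity) hα]
    gcongr
  have main := setIntegral_diff_le (g := g) (μ := volume)
    (measurableSet_cubeSet (subc a e x) s) (measurableSet_cubeSet (subc a e x') s)
    (hg.mono_set hsub) (hg.mono_set hsub') (c := B * (d * (u / s) * s ^ d) ^ α) (by positivity)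
    (hv _ ((measurableSet_cubeSet _ _).diff (measurableSet_cubeSet _ _))
      (sdiff_subset.trans hsub) (cube_diff_volume _ _ hs0 hu hdist))
    (hv _ ((measurableSet_cubeSet _ _).diff (measurableSet_cubeSet _ _))
      (sdiff_subset.trans hsub') (cube_diff_volume _ _ hs0 hu hdist'))
  rw [← mul_sub, abs_mul, abs_of_pos (by positivity)]
  calc (s ^ d)⁻¹ * |(∫ y in cubeSet (subc a e x) s, g y) - ∫ y in cubeSet (subc a e x') s, g y|
      ≤ (s ^ d)⁻¹ * (2 * (B * (d * (u / s) * s ^ d) ^ α)) := by gcongr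
    _ = _ := by
      rw [Real.mul_rpow (by positivity) hsd.le, Real.rpow_sub_one hsd.ne']
      field_simp

theorem Bop_osc {d : ℕ} {a : Fin d → ℝ} {l : ℝ} (hl : 0 < l) {F : Euc d → ℝ}
    (hF : IntegrableOn F (cubeSet a l)) {u Ω : ℝ}
    (hbd : ∀ x ∈ cubeSet a l, ∀ x' ∈ cubeSet a l, (∀ i, |x i - x' i| ≤ u) → |F x - F x'| ≤ Ω)
    {e : ℝ} (he : 0 < e) (he1 : e ≤ 1) {x x' : Euc d} (hx : x ∈ cubeSet a l)
    (hx' : x' ∈ cubeSet a l) (hxx : ∀ i, |x i - x' i| ≤ u) :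
    |Bop a l e F x - Bop a l e F x'| ≤ Ω := by
  unfold Bop
  rw [← mul_sub, ← integral_sub (comp_integrable he he1 hx hF) (comp_integrable he he1 hx' hF),
    abs_mul, abs_of_pos (by positivity), ← Real.norm_eq_abs]
  have hv : volume (cubeSet a l) < ∞ := by rw [volume_cubeSet a l hl.le]; simp
  have := norm_setIntegral_le_of_norm_le_const (μ := volume) (s := cubeSet a l)
    (f := fun y => F (x + e • (y - x)) - F (x' + e • (y - x'))) (C := Ω) hv (by
      intro y hy
      apply hbd _ (cube_combo hx hy he.le he1) _ (cube_combo hx' hy he.le he1)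
      intro i
      simp only [PiLp.add_apply, PiLp.smul_apply, PiLp.sub_apply, smul_eq_mul]
      have h1 : x i + e * (y i - x i) - (x' i + e * (y i - x' i)) = (1 - e) * (x i - x' i) := by ring
      rw [h1, abs_mul, abs_of_nonneg (by linarith)]
      have := hxx i
      have h0 := abs_nonneg (x i - x' i)
      nlinarith)
  rw [Measure.real, volume_cubeSet a l hl.le, ENNReal.toReal_ofReal (by positivity)] at this
  calc (l ^ d)⁻¹ * _ ≤ (l ^ d)⁻¹ * (Ω * l ^ d) := by gcongr
    _ = Ω := by field_simp

theorem sum_choose_le (k : ℕ) : ∑ j ∈ Finset.range k, (k.choose (j+1) : ℝ) ≤ 2 ^ k := by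
  have h := Nat.sum_range_choose k
  rw [Finset.sum_range_succ'] at h
  have h2 : ∑ j ∈ Finset.range k, k.choose (j+1) ≤ 2 ^ k := by omega
  exact_mod_cast h2

theorem Tap_step {d : ℕ} {a : Fin d → ℝ} {l : ℝ} (hl : 0 < l) (k : ℕ) {δ : ℝ} (hδ : 0 < δ)
    (hkδ : k * δ ≤ 1) {f F : Euc d → ℝ} (hf : IntegrableOn f (cubeSet a l))
    (hF : IntegrableOn F (cubeSet a l)) {u Ω B α : ℝ} (hu : 0 ≤ u) (hΩ : 0 ≤ Ω)
    (hB : 0 ≤ B) (hα : 0 ≤ α) (hα1 : α ≤ 1)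
    (hosc : ∀ x ∈ cubeSet a l, ∀ x' ∈ cubeSet a l, (∀ i, |x i - x' i| ≤ u) → |F x - F x'| ≤ Ω)
    (hbd : ∀ E : Set (Euc d), MeasurableSet E → E ⊆ cubeSet a l →
      ∫⁻ x in E, ‖f x - F x‖ₑ ≤ ENNReal.ofReal B * volume E ^ α)
    {x x' : Euc d} (hx : x ∈ cubeSet a l)
    (hx' : x' ∈ cubeSet a l) (hxx : ∀ i, |x i - x' i| ≤ u) :
    |Tap a l k δ f x - Tap a l k δ f x'| ≤
      2 ^ k * (Ω + 2 * B * (d * (u / (δ * l))) ^ α * ((δ * l) ^ d) ^ (α - 1)) := by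
  unfold Tap
  rw [← Finset.sum_sub_distrib]
  have hterm : ∀ j ∈ Finset.range k,
      |(-1) ^ j * (k.choose (j+1) : ℝ) * Bop a l (((j + 1 : ℕ) : ℝ) * δ) f x -
        (-1) ^ j * (k.choose (j+1) : ℝ) * Bop a l (((j + 1 : ℕ) : ℝ) * δ) f x'| ≤
      (k.choose (j+1) : ℝ) * (Ω + 2 * B * (d * (u / (δ * l))) ^ α * ((δ * l) ^ d) ^ (α - 1)) := by
    intro j hj
    have hj1 : (1:ℝ) ≤ ((j + 1 : ℕ) : ℝ) := by exact_mod_cast (by omega : 1 ≤ j + 1)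
    have hjk : ((j + 1 : ℕ) : ℝ) ≤ k := by
      have := Finset.mem_range.1 hj
      exact_mod_cast (by omega : j + 1 ≤ k)
    set e := ((j + 1 : ℕ) : ℝ) * δ with he
    have he0 : 0 < e := by positivity
    have he1 : e ≤ 1 := by nlinarith
    have hδe : δ ≤ e := by nlinarith
    rw [← mul_sub, abs_mul, abs_mul, abs_pow, abs_neg, abs_one, one_pow, one_mul, Nat.abs_cast]
    gcongr
    have hsplit : ∀ z ∈ cubeSet a l, Bop a l e f z = Bop a l e F z + Bop a l e (fun y => f y - F y) z := by
      intro z hz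
      unfold Bop
      rw [← mul_add, ← integral_add (comp_integrable he0 he1 hz hF)
        (comp_integrable (g := fun y => f y - F y) he0 he1 hz (hf.sub hF))]
      congr 2
      funext y; ring
    rw [hsplit x hx, hsplit x' hx']
    have h1 := Bop_osc hl hF hosc he0 he1 hx hx' hxx
    have h2 := Bop_holder hl (hf.sub hF) hB hα hbd he0 he1 hx hx' hu hxx
    have h3 : 2 * B * (d * (u / (e * l))) ^ α * ((e * l) ^ d) ^ (α - 1) ≤
        2 * B * (d * (u / (δ * l))) ^ α * ((δ * l) ^ d) ^ (α - 1) := by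
      have h4 : ((e * l) ^ d) ^ (α - 1) ≤ ((δ * l) ^ d) ^ (α - 1) := by
        apply Real.rpow_le_rpow_of_nonpos (by positivity) _ (by linarith)
        gcongr
      gcongr
    have h5 := abs_add_le (Bop a l e F x - Bop a l e F x')
      (Bop a l e (fun y => f y - F y) x - Bop a l e (fun y => f y - F y) x')
    have h6 : Bop a l e F x + Bop a l e (fun y => f y - F y) x -
      (Bop a l e F x' + Bop a l e (fun y => f y - F y) x') = (Bop a l e F x - Bop a l e F x') +
      (Bop a l e (fun y => f y - F y) x - Bop a l e (fun y => f y - F y) x') := by ring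
    rw [h6]
    exact h5.trans (add_le_add h1 (le_trans h2 h3))
  refine (Finset.abs_sum_le_sum_abs _ _).trans ((Finset.sum_le_sum hterm).trans ?_)
  rw [← Finset.sum_mul]
  have := sum_choose_le k
  gcongr

theorem integrable_of_bound {d : ℕ} {a : Fin d → ℝ} {l : ℝ} (hl : 0 < l) {g : Euc d → ℝ}
    (hgm : Measurable g) {B α : ℝ} (hα : 0 ≤ α)
    (hbd : ∀ E : Set (Euc d), MeasurableSet E → E ⊆ cubeSet a l →
      ∫⁻ x in E, ‖g x‖ₑ ≤ ENNReal.ofReal B * volume E ^ α) : IntegrableOn g (cubeSet a l) := by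
  refine ⟨hgm.aestronglyMeasurable, ?_⟩
  refine (hbd _ (measurableSet_cubeSet a l) Subset.rfl).trans_lt ?_
  rw [volume_cubeSet a l hl.le]
  exact ENNReal.mul_lt_top (by simp) (ENNReal.rpow_lt_top_of_nonneg hα (by simp))

theorem Tap_levels {d : ℕ} {l : ℝ} (hl : 0 < l) (k : ℕ) {δ : ℕ → ℝ} (hδ : ∀ i, 0 < δ i)
    (hkδ : ∀ i, k * δ i ≤ 1) {M : ℝ} (hM1 : 1 ≤ M) (hδM : ∀ i, δ i = M * δ (i + 1)) {α : ℝ} (hα : 0 < α)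
    (hα1 : α ≤ 1) (hM : 2 * 2 ^ k ≤ M ^ α) {D : ℝ} (hD : d * l ≤ D) :
    ∃ C : ℝ, 0 < C ∧ ∀ (a : Fin d → ℝ) (f : Euc d → ℝ) (H : ℝ) (n : ℕ), Measurable f → 0 ≤ H →
      (∀ E : Set (Euc d), MeasurableSet E → E ⊆ cubeSet a l →
        ∫⁻ x in E, ‖f x‖ₑ ≤ ENNReal.ofReal H * volume E ^ α) →
      (∀ i, i < n → ∀ h : Euc d, ‖h‖ ≤ D * δ i → ∀ A : Set (Euc d), MeasurableSet A →
        A ⊆ {x ∈ cubeSet a l | x + (k : ℝ) • h ∈ cubeSet a l} →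
        ∫⁻ x in A, ‖iterDiff k h f x‖ₑ ≤
          ENNReal.ofReal (H * ((δ i) ^ d) ^ (1 - α)) * volume A ^ α) →
      ∀ m, m ≤ n → ∀ u : ℝ, 0 ≤ u → ∀ x ∈ cubeSet a l, ∀ x' ∈ cubeSet a l,
        (∀ i, |x i - x' i| ≤ u) →
        |Tap a l k (δ m) f x - Tap a l k (δ m) f x'| ≤ C * H * (u / δ m) ^ α := by
  set c1 : ℝ := 2 * (d / l) ^ α * (l ^ d) ^ (α - 1) * (δ 0 ^ d) ^ (α - 1) with hc1
  set c2 : ℝ := 2 * 2 ^ d * (M ^ d) ^ (1 - α) * (d / l) ^ α * (l ^ d) ^ (α - 1) with hc2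
  have hc1' : 0 ≤ c1 := by have := hδ 0; positivity
  have hc2' : 0 ≤ c2 := by positivity
  refine ⟨2 * 2 ^ k * (c1 + c2) + 1, by positivity, ?_⟩
  intro a f H n hfm hH h0 hi m
  have hfi := integrable_of_bound hl hfm hα.le h0
  have alg : ∀ (u s : ℝ), 0 ≤ u → 0 < s →
      (d * (u / (s * l))) ^ α * ((s * l) ^ d) ^ (α - 1) =
      (u / s) ^ α * (d / l) ^ α * (l ^ d) ^ (α - 1) * (s ^ d) ^ (α - 1) := by
    intro u s hu hs
    rw [← Real.mul_rpow (by positivity) (by positivity), mul_assoc,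
      ← Real.mul_rpow (by positivity) (by positivity), ← mul_pow]
    congr 2
    · field_simp
    · ring
  induction m with
  | zero =>
    intro _ u hu x hx x' hx' hxx
    have := Tap_step hl k (hδ 0) (hkδ 0) (F := fun _ => 0) hfi integrableOn_zero hu le_rfl hH hα.le
      hα1 (by simp) (by simpa using h0) hx hx' hxx
    refine this.trans ?_
    rw [mul_assoc (2 * H), alg u (δ 0) hu (hδ 0)]
    have hp : 0 ≤ (u / δ 0) ^ α := by have := hδ 0; positivity
    calc 2 ^ k * (0 + 2 * H * ((u / δ 0) ^ α * (d / l) ^ α * (l ^ d) ^ (α - 1) * (δ 0 ^ d) ^ (α - 1)))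
        = (2 ^ k * c1) * H * (u / δ 0) ^ α := by rw [hc1]; ring
      _ ≤ _ := by
        gcongr
        have : 0 ≤ (2:ℝ) ^ k * c1 := by positivity
        have : 0 ≤ (2:ℝ) ^ k * c2 := by positivity
        linarith
  | succ m ih =>
    intro hmn u hu x hx x' hx' hxx
    have ih' := ih (by omega) u hu
    set C := 2 * 2 ^ k * (c1 + c2) + 1 with hC
    have hC0 : 0 < C := by positivity
    have hδm := hδ m
    have hδm1 := hδ (m+1)
    have happ := approx_bound a hl k (hδ m) (hkδ m) hfm hfi hD hα.le (hi m (by omega))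
    have hTm := Tap_measurable a l k (δ m) hfm
    have hdi : IntegrableOn (fun x => f x - Tap a l k (δ m) f x) (cubeSet a l) :=
      integrable_of_bound hl (hfm.sub hTm) hα.le happ
    have hTi : IntegrableOn (Tap a l k (δ m) f) (cubeSet a l) := by
      have := hfi.sub hdi
      refine this.congr (ae_of_all _ ?_)
      intro x; simp
    have := Tap_step hl k (hδ (m+1)) (hkδ (m+1)) hfi hTi hu (by positivity)
      (by positivity) hα.le hα1 ih' happ hx hx' hxx
    refine this.trans ?_
    rw [mul_assoc (2 * _), alg u (δ (m+1)) hu hδm1]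
    have hp : 0 ≤ (u / δ (m+1)) ^ α := by positivity
    have e1 : (u / δ m) ^ α = (u / δ (m+1)) ^ α / M ^ α := by
      rw [← Real.div_rpow (by positivity) (by positivity), hδM m]
      congr 1
      field_simp
    have e2 : (δ m ^ d) ^ (1 - α) * (δ (m+1) ^ d) ^ (α - 1) = (M ^ d) ^ (1 - α) := by
      rw [hδM m, mul_pow, Real.mul_rpow (by positivity) (by positivity), mul_assoc,
        ← Real.rpow_add (by positivity)]
      simp
    have e3 : 2 ^ k / M ^ α ≤ 1 / 2 := by
      rw [div_le_iff₀ (by positivity)]; linarith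
    rw [e1]
    calc _ = (2 ^ k / M ^ α * C + 2 ^ k * (2 * 2 ^ d * ((δ m ^ d) ^ (1 - α) * (δ (m+1) ^ d) ^ (α - 1)) *
            (d / l) ^ α * (l ^ d) ^ (α - 1))) * H * (u / δ (m+1)) ^ α := by ring
      _ = (2 ^ k / M ^ α * C + 2 ^ k * c2) * H * (u / δ (m+1)) ^ α := by rw [e2]
      _ ≤ C * H * (u / δ (m+1)) ^ α := by
        gcongr
        have : 2 ^ k / M ^ α * C ≤ 1 / 2 * C := by gcongr
        have : 0 ≤ (2:ℝ) ^ k * c1 := by positivity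
        linarith

theorem osc_le {d : ℕ} {c : Fin d → ℝ} {u : ℝ} (hu : 0 < u) {f F : Euc d → ℝ}
    (hf : IntegrableOn f (cubeSet c u)) {X Ω : ℝ} (hX : 0 ≤ X)
    (hΩ : 0 ≤ Ω) (hosc : ∀ x ∈ cubeSet c u, ∀ x' ∈ cubeSet c u, |F x - F x'| ≤ Ω)
    (hb : ∫⁻ x in cubeSet c u, ‖f x - F x‖ₑ ≤ ENNReal.ofReal X) :
    (⨍ y in cubeSet c u, |f y - ⨍ z in cubeSet c u, f z|) ≤ 2 * (X / u ^ d) + 2 * Ω := by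
  have hvol := volume_cubeSet c u hu.le
  have hud : 0 < u ^ d := by positivity
  have hreal : volume.real (cubeSet c u) = u ^ d := by
    rw [Measure.real, hvol, ENNReal.toReal_ofReal hud.le]
  have hfin : volume (cubeSet c u) ≠ ∞ := by rw [hvol]; simp
  set x0 : Euc d := WithLp.toLp 2 c with hx0
  have hx0m : x0 ∈ cubeSet c u := by
    intro i; simp only [hx0]; constructor <;> linarith
  set c0 := F x0
  have hconst : ∀ r : ℝ, IntegrableOn (fun _ : Euc d => r) (cubeSet c u) := fun r =>
    integrableOn_const hfin (by simp)
  have h1 : ∫⁻ x in cubeSet c u, ‖f x - c0‖ₑ ≤ ENNReal.ofReal (X + Ω * u ^ d) := by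
    calc ∫⁻ x in cubeSet c u, ‖f x - c0‖ₑ
        ≤ ∫⁻ x in cubeSet c u, (‖f x - F x‖ₑ + ENNReal.ofReal Ω) := by
          apply setLIntegral_mono' (measurableSet_cubeSet _ _)
          intro x hx
          have e : f x - c0 = (f x - F x) + (F x - c0) := by ring
          rw [e]
          refine (enorm_add_le _ _).trans ?_
          gcongr
          rw [← ofReal_norm]
          exact ENNReal.ofReal_le_ofReal (hosc x hx x0 hx0m)
      _ = (∫⁻ x in cubeSet c u, ‖f x - F x‖ₑ) + ENNReal.ofReal Ω * ENNReal.ofReal (u ^ d) := by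
          rw [lintegral_add_right _ measurable_const, setLIntegral_const, hvol]
      _ ≤ ENNReal.ofReal X + ENNReal.ofReal Ω * ENNReal.ofReal (u ^ d) := by gcongr
      _ = _ := by rw [← ENNReal.ofReal_mul hΩ, ← ENNReal.ofReal_add hX (by positivity)]
  have h2 : ∫ x in cubeSet c u, |f x - c0| ≤ X + Ω * u ^ d := by
    have : ∫ x in cubeSet c u, ‖f x - c0‖ = (∫⁻ x in cubeSet c u, ‖f x - c0‖ₑ).toReal :=
      integral_norm_eq_lintegral_enorm (hf.sub (hconst c0)).aestronglyMeasurable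
    simp only [Real.norm_eq_abs] at this
    rw [this]
    exact ENNReal.toReal_le_of_le_ofReal (by positivity) h1
  have habs : IntegrableOn (fun x => |f x - c0|) (cubeSet c u) := (hf.sub (hconst c0)).abs
  set m := ⨍ z in cubeSet c u, f z with hm
  have hmdef : m * u ^ d = ∫ z in cubeSet c u, f z := by
    rw [hm, setAverage_eq, hreal, smul_eq_mul]; field_simp
  have h3 : |c0 - m| * u ^ d ≤ X + Ω * u ^ d := by
    have : (m - c0) * u ^ d = ∫ z in cubeSet c u, (f z - c0) := by
      rw [integral_sub hf (hconst c0), setIntegral_const, hreal, sub_mul, hmdef, smul_eq_mul]; ring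
    rw [abs_sub_comm, ← abs_of_pos hud, ← abs_mul, abs_of_pos hud, this]
    exact (abs_integral_le_integral_abs).trans h2
  have h4 : ∫ y in cubeSet c u, |f y - m| ≤ (X + Ω * u ^ d) + (X + Ω * u ^ d) := by
    calc ∫ y in cubeSet c u, |f y - m| ≤ ∫ y in cubeSet c u, (|f y - c0| + |c0 - m|) := by
          apply setIntegral_mono (hf.sub (hconst m)).abs (habs.add (hconst _))
          intro y
          have := abs_add_le (f y - c0) (c0 - m)
          simpa using this
      _ = (∫ y in cubeSet c u, |f y - c0|) + |c0 - m| * u ^ d := by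
          rw [integral_add habs (hconst _), setIntegral_const, hreal, smul_eq_mul, mul_comm (u ^ d)]
      _ ≤ _ := add_le_add h2 h3
  rw [setAverage_eq, hreal, smul_eq_mul]
  calc (u ^ d)⁻¹ * ∫ y in cubeSet c u, |f y - m| ≤ (u ^ d)⁻¹ * ((X + Ω * u ^ d) + (X + Ω * u ^ d)) := by
        gcongr
    _ = _ := by field_simp; ring

theorem vitali_cubes {d : ℕ} (S Q : Set (Euc d)) (g : Euc d → ℝ≥0∞) (R : ℝ) (t : ℝ≥0∞)
    (h : ∀ x ∈ S, ∃ (c : Fin d → ℝ) (u : ℝ), 0 < u ∧ u ≤ R ∧ x ∈ cubeSet c u ∧ cubeSet c u ⊆ Q ∧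
      t * volume (cubeSet c u) ≤ ∫⁻ y in cubeSet c u, g y) :
    ∃ V : Set (Euc d), MeasurableSet V ∧ V ⊆ Q ∧ volume S ≤ 5 ^ d * volume V ∧
      t * volume V ≤ ∫⁻ y in V, g y := by
  choose! c u hu hR hxm hsub hint using h
  obtain ⟨I, hIS, hdisj, hcov⟩ := Vitali.exists_disjoint_subfamily_covering_enlargement
    (fun x => cubeSet (c x) (u x)) S u 2 (by norm_num) (fun x hx => (hu x hx).le) R hR
    (fun x hx => ⟨x, hxm x hx⟩)
  have hcount : I.Countable := by
    have hd' : Pairwise (Function.onFun Disjoint (fun x : I => cubeSet (c x) (u x))) := by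
      intro x y hxy
      exact hdisj x.2 y.2 (fun h => hxy (Subtype.ext h))
    have := Measure.countable_meas_pos_of_disjoint_iUnion (μ := (volume : Measure (Euc d)))
      (As := fun x : I => cubeSet (c x) (u x)) (fun x => measurableSet_cubeSet _ _) hd'
    have huniv : {i : I | 0 < volume (cubeSet (c i) (u i))} = univ := by
      apply Set.eq_univ_of_forall
      intro x
      show 0 < volume (cubeSet (c x) (u x))
      have hux := hu x (hIS x.2)
      rw [volume_cubeSet _ _ hux.le, ENNReal.ofReal_pos]
      positivity
    rw [huniv] at this
    exact Set.countable_coe_iff.1 (Set.countable_univ_iff.1 this)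
  have hmeas : ∀ x ∈ I, MeasurableSet (cubeSet (c x) (u x)) := fun x _ => measurableSet_cubeSet _ _
  refine ⟨⋃ x ∈ I, cubeSet (c x) (u x), MeasurableSet.biUnion hcount hmeas, ?_, ?_, ?_⟩
  · exact Set.iUnion₂_subset fun x hx => hsub x (hIS hx)
  · have hcover : S ⊆ ⋃ x ∈ I, cubeSet (fun i => c x i - 2 * u x) (5 * u x) := by
      intro x hx
      obtain ⟨b, hb, ⟨z, hz1, hz2⟩, hub⟩ := hcov x hx
      refine Set.mem_biUnion hb ?_
      intro i
      have h1 := hxm x hx i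
      have h2 := hz1 i
      have h3 := hz2 i
      constructor <;> linarith
    refine (measure_mono hcover).trans ((measure_biUnion_le _ hcount _).trans ?_)
    rw [measure_biUnion hcount hdisj hmeas, ← ENNReal.tsum_mul_left]
    apply ENNReal.tsum_le_tsum
    intro x
    have hux := hu x (hIS x.2)
    rw [volume_cubeSet _ _ (by positivity), volume_cubeSet _ _ hux.le, mul_pow,
      ENNReal.ofReal_mul (by positivity)]
    apply le_of_eq
    congr 1
    rw [ENNReal.ofReal_pow (by norm_num)]; simp
  · rw [lintegral_biUnion hcount hmeas hdisj, measure_biUnion hcount hdisj hmeas,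
      ← ENNReal.tsum_mul_left]
    exact ENNReal.tsum_le_tsum fun x => hint x (hIS x.2)

theorem find_level {δ : ℕ → ℝ} {l M u : ℝ} (hl : 0 < l) (hδ : ∀ i, 0 < δ i) (hM1 : 1 ≤ M)
    (hδM : ∀ i, δ i = M * δ (i + 1)) (hul : u ≤ l) (n : ℕ) (hn : δ n * l ≤ u) :
    ∃ m, m ≤ n ∧ δ m * l ≤ u ∧ u ≤ δ m * (M * l + l / δ 0) := by
  induction n with
  | zero =>
    refine ⟨0, le_rfl, hn, hul.trans ?_⟩
    have h0 := hδ 0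
    have : l = δ 0 * (l / δ 0) := by field_simp
    have h2 : 0 ≤ δ 0 * (M * l) := by positivity
    linarith
  | succ n ih =>
    rcases le_or_gt (δ n * l) u with h | h
    · obtain ⟨m, hm, h1⟩ := ih h
      exact ⟨m, by omega, h1⟩
    · refine ⟨n+1, le_rfl, hn, ?_⟩
      have h0 := hδ 0
      have h1 := hδ (n+1)
      rw [hδM n] at h
      have h2 : 0 ≤ δ (n+1) * (l / δ 0) := by positivity
      nlinarith

theorem final_alg {d : ℕ} {C H e v α : ℝ} (hH : 0 < H) (he : 0 < e) (hv : 0 ≤ v) (hα : 0 < α)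
    (hα1 : α < 1) (hC : 4 * 2 ^ d * 5 ^ d ≤ C)
    (h : C / 4 * H * v ≤ 2 ^ d * (H * e ^ (1 - α)) * v ^ α) : 5 ^ d * v ≤ e := by
  rcases hv.eq_or_lt with rfl | hv
  · simpa using he.le
  have hva : 0 < v ^ α := by positivity
  have e1 : v = v ^ (1 - α) * v ^ α := by
    rw [← Real.rpow_add hv]; simp
  have h5 : (5:ℝ) ^ d * v ^ (1 - α) ≤ e ^ (1 - α) := by
    have h1 : (C / 4 * v ^ (1 - α)) * (H * v ^ α) ≤ (2 ^ d * e ^ (1 - α)) * (H * v ^ α) := by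
      calc (C / 4 * v ^ (1 - α)) * (H * v ^ α) = C / 4 * H * (v ^ (1 - α) * v ^ α) := by ring
        _ = C / 4 * H * v := by rw [← e1]
        _ ≤ _ := h
        _ = _ := by ring
    have h2 := le_of_mul_le_mul_right h1 (by positivity)
    have h3 : 2 ^ d * 5 ^ d * v ^ (1 - α) ≤ C / 4 * v ^ (1 - α) := by
      gcongr
      linarith
    have h4 : (2:ℝ) ^ d * (5 ^ d * v ^ (1 - α)) ≤ 2 ^ d * e ^ (1 - α) := by linarith
    exact le_of_mul_le_mul_left h4 (by positivity)
  have h6 : ((5:ℝ) ^ d * v) ^ (1 - α) ≤ e ^ (1 - α) := by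
    rw [Real.mul_rpow (by positivity) hv.le]
    refine le_trans ?_ h5
    gcongr
    have : ((5:ℝ) ^ d) ^ (1 - α) ≤ (5 ^ d) ^ (1:ℝ) := by
      apply Real.rpow_le_rpow_of_exponent_le _ (by linarith)
      exact one_le_pow₀ (by norm_num)
    simpa using this
  exact (Real.rpow_le_rpow_iff (by positivity) he.le (by linarith)).1 h6

theorem key_prop {d : ℕ} (hd : 0 < d) {l : ℝ} (hl : 0 < l) (k : ℕ) {δ : ℕ → ℝ} (hδ : ∀ i, 0 < δ i)
    (hkδ : ∀ i, k * δ i ≤ 1) {M : ℝ} (hM1 : 1 ≤ M) (hδM : ∀ i, δ i = M * δ (i + 1)) {α : ℝ} (hα : 0 < α)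
    (hα1 : α < 1) (hM : 2 * 2 ^ k ≤ M ^ α) {D : ℝ} (hD : d * l ≤ D) :
    ∃ C : ℝ, 0 < C ∧ ∀ (a : Fin d → ℝ) (f : Euc d → ℝ) (H : ℝ) (n : ℕ), Measurable f → 0 < H →
      (∀ E : Set (Euc d), MeasurableSet E → E ⊆ cubeSet a l →
        ∫⁻ x in E, ‖f x‖ₑ ≤ ENNReal.ofReal H * volume E ^ α) →
      (∀ i, i ≤ n → ∀ h : Euc d, ‖h‖ ≤ D * δ i → ∀ A : Set (Euc d), MeasurableSet A →
        A ⊆ {x ∈ cubeSet a l | x + (k : ℝ) • h ∈ cubeSet a l} →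
        ∫⁻ x in A, ‖iterDiff k h f x‖ₑ ≤
          ENNReal.ofReal (H * ((δ i) ^ d) ^ (1 - α)) * volume A ^ α) →
      volume.restrict (cubeSet a l) {x | ENNReal.ofReal (C * H) < sharpLocal volume (cubeSet a l) f x}
        ≤ ENNReal.ofReal (δ n ^ d) := by
  obtain ⟨C3, hC3, hlev⟩ := Tap_levels (d := d) hl k hδ hkδ hM1 hδM hα hα1.le hM hD
  set L := M * l + l / δ 0 with hL
  have hδ0 := hδ 0
  have hL0 : 0 < L := by positivity
  set C := 4 * 2 ^ d * 5 ^ d + 4 * C3 * l ^ α + 2 * 2 ^ d * ((l ^ d)⁻¹) ^ (1 - α) + 2 * C3 * L ^ α with hC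
  have p1 : 0 < C3 * l ^ α := by positivity
  have p2 : 0 < 2 ^ d * ((l ^ d)⁻¹) ^ (1 - α) := by positivity
  have p3 : 0 < C3 * L ^ α := by positivity
  have p4 : (0:ℝ) < 2 ^ d * 5 ^ d := by positivity
  have hC0 : 0 < C := by positivity
  refine ⟨C, hC0, ?_⟩
  intro a f H n hfm hH h0 hi
  have hfi := integrable_of_bound hl hfm hα.le h0
  have hosc := hlev a f H n hfm hH.le h0 (fun i hin => hi i hin.le)
  have happ : ∀ m ≤ n, ∀ E : Set (Euc d), MeasurableSet E → E ⊆ cubeSet a l →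
      ∫⁻ x in E, ‖f x - Tap a l k (δ m) f x‖ₑ ≤
        ENNReal.ofReal (2 ^ d * (H * (δ m ^ d) ^ (1 - α))) * volume E ^ α := fun m hm =>
    approx_bound a hl k (hδ m) (hkδ m) hfm hfi hD hα.le (hi m hm)
  have hoscQ : ∀ m ≤ n, ∀ (c : Fin d → ℝ) (u : ℝ), 0 < u → cubeSet c u ⊆ cubeSet a l →
      ∀ x ∈ cubeSet c u, ∀ x' ∈ cubeSet c u,
      |Tap a l k (δ m) f x - Tap a l k (δ m) f x'| ≤ C3 * H * (u / δ m) ^ α := by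
    intro m hm c u hu hsub x hx x' hx'
    apply hosc m hm u hu.le x (hsub hx) x' (hsub hx')
    intro i
    have h1 := hx i
    have h2 := hx' i
    rw [abs_le]; constructor <;> linarith
  set S := {x | ENNReal.ofReal (C * H) < sharpLocal volume (cubeSet a l) f x} ∩ cubeSet a l with hS
  have hcubes : ∀ x ∈ S, ∃ (c : Fin d → ℝ) (u : ℝ), 0 < u ∧ u ≤ l ∧ x ∈ cubeSet c u ∧
      cubeSet c u ⊆ cubeSet a l ∧
      ENNReal.ofReal (C / 4 * H) * volume (cubeSet c u) ≤
        ∫⁻ y in cubeSet c u, ‖f y - Tap a l k (δ n) f y‖ₑ := by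
    rintro x ⟨hx, -⟩
    change ENNReal.ofReal (C * H) < sharpLocal volume (cubeSet a l) f x at hx
    unfold sharpLocal at hx
    rw [lt_iSup_iff] at hx
    obtain ⟨Q, hx⟩ := hx
    rw [lt_iSup_iff] at hx
    obtain ⟨⟨⟨c, u, hu, rfl⟩, hxQ, hsub⟩, hx⟩ := hx
    have hlt : C * H < ⨍ y in cubeSet c u, |f y - ⨍ z in cubeSet c u, f z| :=
      (ENNReal.ofReal_lt_ofReal_iff_of_nonneg (by positivity)).1 hx
    have hul : u ≤ l := by
      have h1 : WithLp.toLp 2 c ∈ cubeSet c u := by intro i; simp; linarith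
      have h2 : WithLp.toLp 2 (fun i => c i + u) ∈ cubeSet c u := by intro i; simp; linarith
      have h3 := hsub h1 ⟨0, hd⟩
      have h4 := hsub h2 ⟨0, hd⟩
      simp at h3 h4
      linarith
    refine ⟨c, u, hu, hul, hxQ, hsub, ?_⟩
    have hvol := volume_cubeSet c u hu.le
    have hud : 0 < u ^ d := by positivity
    have hfQ := hfi.mono_set hsub
    have husmall : u < δ n * l := by
      by_contra hcon
      push Not at hcon
      obtain ⟨m, hm, hm1, hm2⟩ := find_level hl hδ hM1 hδM hul n hcon
      have hδm := hδ m
      have hX := happ m hm (cubeSet c u) (measurableSet_cubeSet _ _) hsub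
      rw [hvol, ENNReal.ofReal_rpow_of_nonneg hud.le hα.le, ← ENNReal.ofReal_mul (by positivity)] at hX
      have := osc_le hu hfQ (by positivity) (by positivity) (hoscQ m hm c u hu hsub) hX
      have e1 : 2 ^ d * (H * (δ m ^ d) ^ (1 - α)) * (u ^ d) ^ α / u ^ d =
          2 ^ d * H * ((δ m / u) ^ d) ^ (1 - α) := by
        rw [div_pow, Real.div_rpow (by positivity) (by positivity), Real.rpow_sub hud, Real.rpow_one]
        field_simp
      have e2 : ((δ m / u) ^ d) ^ (1 - α) ≤ ((l ^ d)⁻¹) ^ (1 - α) := by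
        rw [← inv_pow]
        have : δ m / u ≤ l⁻¹ := by
          rw [div_le_iff₀ hu, ← div_eq_inv_mul, le_div_iff₀ hl]; exact hm1
        have : 0 ≤ 1 - α := by linarith
        gcongr
      have e3 : (u / δ m) ^ α ≤ L ^ α := by
        have : u / δ m ≤ L := by rw [div_le_iff₀ hδm]; linarith
        gcongr
      rw [e1] at this
      have e4 : 2 ^ d * H * ((δ m / u) ^ d) ^ (1 - α) ≤ 2 ^ d * H * ((l ^ d)⁻¹) ^ (1 - α) := by gcongr
      have e5 : C3 * H * (u / δ m) ^ α ≤ C3 * H * L ^ α := by gcongr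
      have e6 : 0 ≤ (4 * 2 ^ d * 5 ^ d + 4 * C3 * l ^ α) * H := by positivity
      have e7 : C * H = (4 * 2 ^ d * 5 ^ d + 4 * C3 * l ^ α) * H +
        2 * (2 ^ d * H * ((l ^ d)⁻¹) ^ (1 - α)) + 2 * (C3 * H * L ^ α) := by rw [hC]; ring
      linarith
    have hδn := hδ n
    set I := ∫⁻ y in cubeSet c u, ‖f y - Tap a l k (δ n) f y‖ₑ with hI
    have hIfin : I ≠ ∞ := by
      apply ne_of_lt
      refine (happ n le_rfl (cubeSet c u) (measurableSet_cubeSet _ _) hsub).trans_lt ?_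
      rw [hvol]
      exact ENNReal.mul_lt_top ENNReal.ofReal_lt_top (ENNReal.rpow_lt_top_of_nonneg hα.le (by simp))
    have := osc_le hu hfQ ENNReal.toReal_nonneg (by positivity) (hoscQ n le_rfl c u hu hsub)
      (ENNReal.ofReal_toReal hIfin).ge
    have e3 : C3 * H * (u / δ n) ^ α ≤ C3 * H * l ^ α := by
      have : u / δ n ≤ l := by rw [div_le_iff₀ hδn]; linarith
      gcongr
    have e4 : C / 4 * H ≤ I.toReal / u ^ d := by
      have e5 : 4 * C3 * l ^ α * H ≤ C * H := by
        gcongr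
        linarith
      have e6 : C3 * H * l ^ α = C3 * l ^ α * H := by ring
      linarith
    rw [le_div_iff₀ hud] at e4
    rw [hvol, ← ENNReal.ofReal_mul (by positivity), ← ENNReal.ofReal_toReal hIfin]
    exact ENNReal.ofReal_le_ofReal e4
  obtain ⟨V, hVm, hVQ, hSV, hVint⟩ := vitali_cubes S (cubeSet a l) _ l _ hcubes
  rw [Measure.restrict_apply' (measurableSet_cubeSet a l)]
  refine hSV.trans ?_
  have hVfin : volume V ≠ ∞ := by
    apply ne_of_lt
    refine (measure_mono hVQ).trans_lt ?_
    rw [volume_cubeSet a l hl.le]; simp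
  have hδn := hδ n
  have hfin := hVint.trans (happ n le_rfl V hVm hVQ)
  rw [← ENNReal.ofReal_toReal hVfin] at hfin ⊢
  have hv0 : 0 ≤ (volume V).toReal := ENNReal.toReal_nonneg
  set v := (volume V).toReal
  rw [ENNReal.ofReal_rpow_of_nonneg hv0 hα.le, ← ENNReal.ofReal_mul (by positivity),
    ← ENNReal.ofReal_mul (by positivity), ENNReal.ofReal_le_ofReal_iff (by positivity)] at hfin
  have h5 : (5:ℝ≥0∞) ^ d = ENNReal.ofReal (5 ^ d) := by
    rw [ENNReal.ofReal_pow (by norm_num)]; simp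
  rw [h5, ← ENNReal.ofReal_mul (by positivity)]
  apply ENNReal.ofReal_le_ofReal
  exact final_alg hH (by positivity) hv0 hα hα1 (by linarith) hfin

theorem rearr_anti {X : Type*} [MeasurableSpace X] (μ : Measure X) (g : X → ℝ≥0∞) :
    Antitone (rearr μ g) := by
  intro s t hst
  apply sInf_le_sInf
  intro l hl
  exact (show μ {x | l < g x} ≤ ENNReal.ofReal s from hl).trans (ENNReal.ofReal_le_ofReal hst)

theorem meas_le_of_rearr_lt {X : Type*} [MeasurableSpace X] {μ : Measure X} {g : X → ℝ≥0∞}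
    {t : ℝ} {l : ℝ≥0∞} (h : rearr μ g t < l) : μ {x | l < g x} ≤ ENNReal.ofReal t := by
  obtain ⟨l', hl', hlt⟩ := sInf_lt_iff.1 h
  refine le_trans (measure_mono ?_) (show μ {x | l' < g x} ≤ ENNReal.ofReal t from hl')
  intro x hx
  exact hlt.trans hx

theorem weak_bound {p : ℝ} (hp : 1 < p) {q : ℝ≥0∞} (hq : 0 < q) :
    ∃ c : ℝ, 0 < c ∧ ∀ {X : Type} [MeasurableSpace X] (μ : Measure X) (f : X → ℝ), ∀ s ∈ Ioo (0:ℝ) 1,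
      ENNReal.ofReal (s ^ (1 / p)) * rearrR μ f s ≤ ENNReal.ofReal c * lorentz μ f p q (Ioo 0 1) := by
  by_cases hqi : q = ∞
  · refine ⟨1, one_pos, ?_⟩
    intro X _ μ f s hs
    unfold lorentz qnorm
    rw [if_pos hqi, ENNReal.ofReal_one, one_mul]
    exact le_iSup₂ (f := fun t (_ : t ∈ Ioo (0:ℝ) 1) => ENNReal.ofReal (t ^ (1 / p)) * rearrR μ f t) s hs
  · set Q := q.toReal with hQ
    have hQ0 : 0 < Q := ENNReal.toReal_pos hq.ne' hqi
    refine ⟨2 ^ (1 / p) * 2 ^ (1 / Q), by positivity, ?_⟩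
    intro X _ μ f s hs
    unfold lorentz qnorm
    rw [if_neg hqi]
    have hs0 := hs.1
    set A := ENNReal.ofReal ((s / 2) ^ (1 / p)) * rearrR μ f s with hA
    have h1 : A ^ Q / ENNReal.ofReal s * ENNReal.ofReal (s / 2) ≤
        ∫⁻ t in Ioo (0:ℝ) 1, (ENNReal.ofReal (t ^ (1 / p)) * rearrR μ f t) ^ q.toReal / ENNReal.ofReal t := by
      calc A ^ Q / ENNReal.ofReal s * ENNReal.ofReal (s / 2)
          = ∫⁻ t in Ioo (s / 2) s, A ^ Q / ENNReal.ofReal s := by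
            rw [setLIntegral_const, Real.volume_Ioo]; congr 2; ring
        _ ≤ ∫⁻ t in Ioo (s / 2) s, (ENNReal.ofReal (t ^ (1 / p)) * rearrR μ f t) ^ q.toReal / ENNReal.ofReal t := by
            apply setLIntegral_mono' measurableSet_Ioo
            intro t ht
            have ht1 := ht.1
            have ht2 := ht.2
            have hmono : rearrR μ f s ≤ rearrR μ f t := rearr_anti _ _ ht2.le
            have hAle : A ≤ ENNReal.ofReal (t ^ (1 / p)) * rearrR μ f t := by
              rw [hA]; gcongr
            gcongr
        _ ≤ _ := by
            apply lintegral_mono_set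
            intro t ht
            exact ⟨by linarith [ht.1], by linarith [ht.2, hs.2]⟩
    have h2 : A ^ Q / ENNReal.ofReal s * ENNReal.ofReal (s / 2) = A ^ Q * ENNReal.ofReal (1 / 2) := by
      rw [div_eq_mul_inv, mul_assoc, ← ENNReal.ofReal_inv_of_pos hs0,
        ← ENNReal.ofReal_mul (by positivity)]
      congr 2
      field_simp
    rw [h2] at h1
    set I := ∫⁻ t in Ioo (0:ℝ) 1, (ENNReal.ofReal (t ^ (1 / p)) * rearrR μ f t) ^ q.toReal / ENNReal.ofReal t
    have h3 : A ^ Q ≤ ENNReal.ofReal 2 * I := by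
      calc A ^ Q = ENNReal.ofReal 2 * (A ^ Q * ENNReal.ofReal (1 / 2)) := by
            rw [mul_left_comm, ← ENNReal.ofReal_mul (by norm_num)]; norm_num
        _ ≤ _ := by gcongr
    have h4 : A ≤ ENNReal.ofReal (2 ^ (1 / Q)) * I ^ (1 / Q) := by
      have := ENNReal.rpow_le_rpow h3 (z := 1 / Q) (by positivity)
      rw [← ENNReal.rpow_mul, mul_one_div_cancel hQ0.ne', ENNReal.rpow_one,
        ENNReal.mul_rpow_of_nonneg _ _ (by positivity),
        ENNReal.ofReal_rpow_of_pos (by norm_num)] at this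
      exact this
    have h5 : ENNReal.ofReal (s ^ (1 / p)) * rearrR μ f s = ENNReal.ofReal (2 ^ (1 / p)) * A := by
      rw [hA, ← mul_assoc, ← ENNReal.ofReal_mul (by positivity), ← Real.mul_rpow (by positivity) (by positivity)]
      congr 3
      ring
    rw [h5, ENNReal.ofReal_mul (by positivity), mul_assoc]
    gcongr

theorem lorentz_holder {p : ℝ} (hp : 1 < p) {q : ℝ≥0∞} (hq : 0 < q) {v : ℝ} (hv : 0 < v) :
    ∃ C : ℝ, 0 < C ∧ ∀ {X : Type} [MeasurableSpace X] (μ : Measure X) (f : X → ℝ) (A : Set X) (N : ℝ),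
      Measurable f → μ A ≤ ENNReal.ofReal v → 0 < N →
      lorentz μ f p q (Ioo 0 1) ≤ ENNReal.ofReal N →
      ∫⁻ x in A, ‖f x‖ₑ ∂μ ≤ ENNReal.ofReal (C * N) * μ A ^ (1 - 1 / p) := by
  obtain ⟨c, hc, hweak⟩ := weak_bound hp hq
  set κ := 1 + v ^ (1 / p) with hκ
  have hκ1 : 1 ≤ κ := by have : 0 < v ^ (1 / p) := by positivity
                         linarith
  have hp1 : 0 < p - 1 := by linarith
  have hp0 : 0 < p := by linarith
  refine ⟨2 * c * (κ + 1 / (p - 1)), by positivity, ?_⟩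
  intro X _ μ f A N hf hAv hN hL
  by_cases hA0 : μ A = 0
  · rw [Measure.restrict_eq_zero.2 hA0]; simp
  have hAfin : μ A ≠ ∞ := ne_top_of_le_ne_top ENNReal.ofReal_ne_top hAv
  set m := (μ A).toReal with hm
  have hm0 : 0 < m := ENNReal.toReal_pos hA0 hAfin
  have hmA : μ A = ENNReal.ofReal m := (ENNReal.ofReal_toReal hAfin).symm
  have hmv : m ≤ v := ENNReal.toReal_le_of_le_ofReal hv.le hAv
  set N2 := 2 * c * N with hN2
  have hN20 : 0 < N2 := by positivity
  have hdist : ∀ t, N2 < t → μ {x | t < |f x|} ≤ ENNReal.ofReal (N2 ^ p * t ^ (-p)) := by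
    intro t ht
    have ht0 : 0 < t := hN20.trans ht
    set s := (N2 / t) ^ p with hs
    have hst : N2 / t < 1 := by rw [div_lt_one ht0]; exact ht
    have hs0 : 0 < s := by positivity
    have hs1 : s < 1 := Real.rpow_lt_one (by positivity) hst hp0
    have hsp : s ^ (1 / p) = N2 / t := by
      rw [hs, ← Real.rpow_mul (by positivity), mul_one_div_cancel hp0.ne', Real.rpow_one]
    have h1 := (hweak μ f s ⟨hs0, hs1⟩).trans (mul_le_mul' le_rfl hL)
    rw [hsp, ← ENNReal.ofReal_mul hc.le] at h1
    have h2 : rearrR μ f s < ENNReal.ofReal t := by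
      by_contra hcon
      push Not at hcon
      have h3 : ENNReal.ofReal (N2 / t) * ENNReal.ofReal t ≤ ENNReal.ofReal (c * N) :=
        (mul_le_mul' le_rfl hcon).trans h1
      rw [← ENNReal.ofReal_mul (by positivity), ENNReal.ofReal_le_ofReal_iff (by positivity),
        div_mul_cancel₀ _ ht0.ne'] at h3
      have : 0 < c * N := by positivity
      rw [hN2] at h3
      linarith
    have h4 := meas_le_of_rearr_lt h2
    have e : {x | t < |f x|} = {x | ENNReal.ofReal t < ENNReal.ofReal |f x|} := by
      ext x
      simp only [Set.mem_ofPred_eq]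
      rw [ENNReal.ofReal_lt_ofReal_iff_of_nonneg ht0.le]
    rw [e]
    refine h4.trans (le_of_eq ?_)
    rw [hs, Real.div_rpow hN20.le ht0.le, Real.rpow_neg ht0.le, div_eq_mul_inv]
  set Λ := κ * N2 * m ^ (-(1 / p)) with hΛ
  have hΛ0 : 0 < Λ := by positivity
  have hΛN : N2 ≤ Λ := by
    have h1 : v ^ (-(1 / p)) ≤ m ^ (-(1 / p)) :=
      Real.rpow_le_rpow_of_nonpos hm0 hmv (by have : 0 < 1 / p := by positivity
                                              linarith)
    have h2 : 1 ≤ κ * v ^ (-(1/p)) := by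
      rw [hκ, add_mul, ← Real.rpow_add hv]
      have : 0 < v ^ (-(1/p)) := by positivity
      rw [add_neg_cancel, Real.rpow_zero]; linarith
    have h3 : κ * v ^ (-(1/p)) ≤ κ * m ^ (-(1/p)) := by gcongr
    calc N2 = N2 * 1 := by ring
      _ ≤ N2 * (κ * m ^ (-(1/p))) := by gcongr; linarith
      _ = Λ := by rw [hΛ]; ring
  have hnorm : ∀ x, ‖f x‖ₑ = ENNReal.ofReal |f x| := fun x => by
    rw [← ofReal_norm, Real.norm_eq_abs]
  simp only [hnorm]
  rw [lintegral_eq_lintegral_meas_lt (μ.restrict A) (ae_of_all _ fun x => abs_nonneg (f x))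
    hf.abs.aemeasurable, ← Ioc_union_Ioi_eq_Ioi hΛ0.le]
  refine (lintegral_union_le _ _ _).trans ?_
  have b1 : ∫⁻ t in Ioc 0 Λ, (μ.restrict A) {x | t < |f x|} ≤ ENNReal.ofReal (m * Λ) := by
    calc ∫⁻ t in Ioc 0 Λ, (μ.restrict A) {x | t < |f x|} ≤ ∫⁻ t in Ioc 0 Λ, ENNReal.ofReal m := by
          apply lintegral_mono
          intro t
          show (μ.restrict A) {x | t < |f x|} ≤ ENNReal.ofReal m
          rw [← hmA, ← Measure.restrict_apply_univ A]
          exact measure_mono (subset_univ _)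
      _ = _ := by
          rw [setLIntegral_const, Real.volume_Ioc, sub_zero, ← ENNReal.ofReal_mul hm0.le]
  have b2 : ∫⁻ t in Ioi Λ, (μ.restrict A) {x | t < |f x|} ≤
      ENNReal.ofReal (N2 ^ p * (Λ ^ (1 - p) / (p - 1))) := by
    calc ∫⁻ t in Ioi Λ, (μ.restrict A) {x | t < |f x|}
        ≤ ∫⁻ t in Ioi Λ, ENNReal.ofReal (N2 ^ p * t ^ (-p)) := by
          apply setLIntegral_mono' measurableSet_Ioi
          intro t ht
          exact (Measure.restrict_apply_le _ _).trans (hdist t (hΛN.trans_lt ht))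
      _ = ENNReal.ofReal (∫ t in Ioi Λ, N2 ^ p * t ^ (-p)) := by
          rw [ofReal_integral_eq_lintegral_ofReal]
          · exact (integrableOn_Ioi_rpow_of_lt (by linarith) hΛ0).const_mul _
          · filter_upwards [self_mem_ae_restrict measurableSet_Ioi] with t ht
            have : 0 < t := hΛ0.trans ht
            positivity
      _ = _ := by
          rw [integral_const_mul, integral_Ioi_rpow_of_lt (by linarith) hΛ0]
          congr 2
          have : -p + 1 = -(p - 1) := by ring
          rw [this, neg_div_neg_eq]
          congr 2; ring
  refine (add_le_add b1 b2).trans ?_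
  rw [hmA, ENNReal.ofReal_rpow_of_pos hm0, ← ENNReal.ofReal_mul (by positivity),
    ← ENNReal.ofReal_add (by positivity) (by positivity)]
  apply ENNReal.ofReal_le_ofReal
  have e1 : m * Λ = κ * N2 * m ^ (1 - 1 / p) := by
    rw [hΛ, sub_eq_add_neg, Real.rpow_add hm0, Real.rpow_one]; ring
  have e2 : N2 ^ p * (Λ ^ (1 - p) / (p - 1)) ≤ 1 / (p - 1) * N2 * m ^ (1 - 1 / p) := by
    have h1 : Λ ^ (1 - p) = κ ^ (1 - p) * N2 ^ (1 - p) * m ^ (1 - 1 / p) := by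
      rw [hΛ, Real.mul_rpow (by positivity) (by positivity), Real.mul_rpow (by positivity) (by positivity),
        ← Real.rpow_mul hm0.le]
      congr 2
      field_simp
      ring
    have h2 : κ ^ (1 - p) ≤ 1 := Real.rpow_le_one_of_one_le_of_nonpos hκ1 (by linarith)
    have h3 : N2 ^ p * N2 ^ (1 - p) = N2 := by rw [← Real.rpow_add hN20]; simp
    rw [h1]
    calc N2 ^ p * (κ ^ (1 - p) * N2 ^ (1 - p) * m ^ (1 - 1 / p) / (p - 1))
        = κ ^ (1 - p) * ((N2 ^ p * N2 ^ (1 - p)) * m ^ (1 - 1 / p) / (p - 1)) := by ring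
      _ ≤ 1 * ((N2 ^ p * N2 ^ (1 - p)) * m ^ (1 - 1 / p) / (p - 1)) := by gcongr
      _ = _ := by rw [h3]; ring
  rw [e1]
  refine (add_le_add le_rfl e2).trans (le_of_eq ?_)
  rw [hN2]; ring

theorem pointwise_bound {d : ℕ} (hd : 0 < d) {l : ℝ} (hl : 0 < l) {p : ℝ} (hp : 1 < p) {q : ℝ≥0∞}
    (hq : 0 < q) {k : ℕ} (hk : 0 < k) :
    ∃ C c M : ℝ, 0 < C ∧ 0 < c ∧ c ≤ 1 ∧ 1 < M ∧
      ∀ (a : Fin d → ℝ) (f : Euc d → ℝ) (t : ℝ) (Y : ℝ≥0∞), Measurable f → t ∈ Ioo (0:ℝ) 1 →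
        lorentz (volume.restrict (cubeSet a l)) f p q (Ioo 0 1) ≤ Y →
        (∀ u : ℝ, 0 < u → u ≤ 1 / M → c * t ^ (1 / (d : ℝ)) ≤ u →
          modulusQ (cubeSet a l) k f p q u ≤ Y * ENNReal.ofReal (u ^ ((d : ℝ) / p))) →
        rearr (volume.restrict (cubeSet a l)) (sharpLocal volume (cubeSet a l) f) t
          ≤ ENNReal.ofReal C * Y := by
  have hp0 : 0 < p := by linarith
  have hd0 : (0:ℝ) < d := by exact_mod_cast hd
  have hk1 : (1:ℝ) ≤ k := by exact_mod_cast hk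
  have hk0 : (0:ℝ) < k := by linarith
  set α := 1 - 1 / p with hα
  have hp1 : 1 / p < 1 := by rw [div_lt_one hp0]; exact hp
  have hpp : 0 < 1 / p := by positivity
  have hα0 : 0 < α := by linarith
  have hα1 : α < 1 := by linarith
  have h1α : 1 - α = 1 / p := by rw [hα]; ring
  have h2k : (1:ℝ) ≤ 2 ^ k := one_le_pow₀ (by norm_num)
  set M := (2 * 2 ^ k : ℝ) ^ (1 / α) with hM
  have hMα : M ^ α = 2 * 2 ^ k := by
    rw [hM, ← Real.rpow_mul (by positivity), one_div_mul_cancel hα0.ne', Real.rpow_one]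
  have hM1 : 1 < M := Real.one_lt_rpow (by linarith) (by positivity)
  have hM0 : 0 < M := by linarith
  set D := d * l + 1 with hD
  have hD1 : 1 ≤ D := by have : 0 < d * l := by positivity
                         linarith
  have hD0 : 0 < D := by linarith
  set c := 1 / (k * M) with hc
  have hc0 : 0 < c := by positivity
  have hcM : c ≤ 1 / M := by
    rw [hc]; apply one_div_le_one_div_of_le hM0; nlinarith
  have h1M : 1 / M ≤ 1 := by rw [div_le_one hM0]; exact hM1.le
  set δ : ℕ → ℝ := fun i => c / D / M ^ i with hδ
  have hδ0 : ∀ i, 0 < δ i := fun i => by simp only [hδ]; positivity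
  have hδM : ∀ i, δ i = M * δ (i + 1) := fun i => by
    simp only [hδ]; rw [pow_succ]; field_simp
  have hMi : ∀ i : ℕ, 1 ≤ M ^ i := fun i => one_le_pow₀ hM1.le
  have hDδ : ∀ i, D * δ i = c / M ^ i := fun i => by simp only [hδ]; field_simp
  have hDδc : ∀ i, D * δ i ≤ c := fun i => by
    rw [hDδ, div_le_iff₀ (by positivity)]
    nlinarith [hMi i]
  have hδc : ∀ i, δ i ≤ c := fun i => by nlinarith [hDδc i, hδ0 i]
  have hkδ : ∀ i, k * δ i ≤ 1 := fun i => by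
    calc k * δ i ≤ k * c := by gcongr; exact hδc i
      _ = 1 / M := by rw [hc]; field_simp
      _ ≤ 1 := h1M
  have hanti : ∀ i j, i ≤ j → δ j ≤ δ i := fun i j hij => by
    simp only [hδ]
    gcongr
    exact hM1.le
  obtain ⟨C1, hC1, hkey⟩ := key_prop (d := d) hd hl k hδ0 hkδ hM1.le hδM hα0 hα1 hMα.ge
    (show d * l ≤ D by linarith)
  obtain ⟨C2, hC2, hhol⟩ := lorentz_holder hp hq (v := l ^ d) (by positivity)
  set B := D ^ ((d : ℝ) / p) with hB
  have hB1 : 1 ≤ B := Real.one_le_rpow hD1 (by positivity)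
  refine ⟨C1 * (C2 * B), c, M, by positivity, hc0, hcM.trans h1M, hM1, ?_⟩
  intro a f t Y hf ht hN hω
  have ht0 := ht.1
  have ht1 := ht.2
  have main : ∀ H : ℝ, 0 < H → Y ≤ ENNReal.ofReal H →
      rearr (volume.restrict (cubeSet a l)) (sharpLocal volume (cubeSet a l) f) t
        ≤ ENNReal.ofReal (C1 * (C2 * B) * H) := by
    intro H hH hYH
    have hex : ∃ n, δ n ^ d ≤ t := by
      obtain ⟨n, hn⟩ := exists_pow_lt_of_lt_one ht0 (show 1 / M < 1 by rw [div_lt_one hM0]; exact hM1)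
      refine ⟨n, ?_⟩
      have h1 : δ n ≤ 1 := (hδc n).trans (hcM.trans h1M)
      have h2 : δ n ≤ (1 / M) ^ n := by
        rw [one_div, inv_pow]
        have : δ n = c / D * (M ^ n)⁻¹ := by simp only [hδ]; rw [div_eq_mul_inv]
        rw [this]
        have h3 : c / D ≤ 1 := by
          rw [div_le_one hD0]; linarith [hcM.trans h1M]
        have : 0 < (M ^ n)⁻¹ := by positivity
        nlinarith
      calc δ n ^ d ≤ δ n ^ 1 := pow_le_pow_of_le_one (hδ0 n).le h1 hd
        _ ≤ _ := by rw [pow_one]; exact h2.trans hn.le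
    classical
    set n := Nat.find hex with hn
    have hnt : δ n ^ d ≤ t := Nat.find_spec hex
    have hlow : ∀ i, i ≤ n → c * t ^ (1 / (d:ℝ)) ≤ D * δ i := by
      intro i hi
      have ht1' : t ^ (1 / (d:ℝ)) ≤ 1 := Real.rpow_le_one ht0.le ht1.le (by positivity)
      rcases Nat.eq_zero_or_pos n with h0 | h0
      · have : i = 0 := by omega
        rw [this, hDδ, pow_zero, div_one]
        nlinarith
      · have h1 : ¬ (δ (n - 1) ^ d ≤ t) := Nat.find_min hex (by omega)
        push Not at h1
        have h2 : t ^ (1 / (d:ℝ)) ≤ δ (n - 1) := by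
          have := Real.rpow_le_rpow ht0.le h1.le (show 0 ≤ 1 / (d:ℝ) by positivity)
          rwa [one_div, Real.pow_rpow_inv_natCast (hδ0 _).le hd.ne', ← one_div] at this
        have h3 : δ (n - 1) = M * δ n := by
          have := hδM (n - 1)
          rwa [Nat.sub_add_cancel h0] at this
        calc c * t ^ (1 / (d:ℝ)) ≤ 1 / M * (M * δ n) := by
              rw [← h3]; gcongr
          _ = δ n := by field_simp
          _ ≤ δ i := hanti i n hi
          _ ≤ D * δ i := by nlinarith [hδ0 i]
    apply sInf_le
    show volume.restrict (cubeSet a l) {x | ENNReal.ofReal (C1 * (C2 * B) * H) <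
      sharpLocal volume (cubeSet a l) f x} ≤ ENNReal.ofReal t
    have hvolQ := volume_cubeSet a l hl.le
    have := hkey a f (C2 * B * H) n hf (by positivity) ?_ ?_
    · rw [show C1 * (C2 * B) * H = C1 * (C2 * B * H) by ring]
      exact this.trans (ENNReal.ofReal_le_ofReal hnt)
    · intro E hE hEQ
      have h1 := hhol (volume.restrict (cubeSet a l)) f E H hf ?_ hH (hN.trans hYH)
      · rw [Measure.restrict_restrict hE, Measure.restrict_apply hE, inter_eq_self_of_subset_left hEQ] at h1
        refine h1.trans ?_
        gcongr
        nlinarith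
      · rw [Measure.restrict_apply hE, ← hvolQ]
        exact measure_mono inter_subset_right
    · intro i hi h hh A hA hAs
      set S : Set (Euc d) := {x ∈ cubeSet a l | x + (k : ℝ) • h ∈ cubeSet a l} with hS
      have hSQ : S ⊆ cubeSet a l := fun x hx => hx.1
      have hu0 : 0 < D * δ i := mul_pos hD0 (hδ0 i)
      have hmod := hω (D * δ i) hu0 ((hDδc i).trans hcM) (hlow i hi)
      have hdm : Measurable (iterDiff k h f) := by
        have : iterDiff k h f = fun x => ∑ j ∈ Finset.range (k + 1), (((-1 : ℤ) ^ (k - j) * (k.choose j : ℤ)) • f (x + j • h)) := by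
          funext x
          rw [show iterDiff k h f x = (fwdDiff h)^[k] f x from rfl, fwdDiff_iter_eq_sum_shift]
        rw [this]
        fun_prop
      have hle : lorentz (volume.restrict S) (iterDiff k h f) p q (Ioo 0 1) ≤
          ENNReal.ofReal (H * (B * (δ i ^ d) ^ (1 / p))) := by
        calc lorentz (volume.restrict S) (iterDiff k h f) p q (Ioo 0 1)
            ≤ modulusQ (cubeSet a l) k f p q (D * δ i) := by
              unfold modulusQ
              exact le_iSup₂ (f := fun h (_ : h ∈ {h : Euc d | ‖h‖ ≤ D * δ i}) =>
                lorentz (volume.restrict {x ∈ cubeSet a l | x + (k : ℝ) • h ∈ cubeSet a l})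
                  (iterDiff k h f) p q (Set.Ioo 0 1)) h hh
          _ ≤ ENNReal.ofReal H * ENNReal.ofReal ((D * δ i) ^ ((d : ℝ) / p)) := hmod.trans (by gcongr)
          _ = _ := by
              rw [← ENNReal.ofReal_mul hH.le, Real.mul_rpow hD0.le (hδ0 i).le,
                ← Real.rpow_natCast (δ i) d, ← Real.rpow_mul (hδ0 i).le, mul_one_div]
      have hδp : 0 < (δ i ^ d) ^ (1 / p) := Real.rpow_pos_of_pos (pow_pos (hδ0 i) d) _
      have h1 := hhol (volume.restrict S) (iterDiff k h f) A _ hdm ?_ (by positivity) hle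
      · rw [Measure.restrict_restrict hA, Measure.restrict_apply hA, inter_eq_self_of_subset_left hAs] at h1
        refine h1.trans (le_of_eq ?_)
        rw [h1α]
        congr 2
        ring
      · rw [Measure.restrict_apply hA, ← hvolQ]
        exact measure_mono (inter_subset_right.trans hSQ)
  set K := C1 * (C2 * B) with hK
  have hK0 : 0 < K := by positivity
  by_cases hY : Y = ∞
  · rw [hY, ENNReal.mul_top (by simpa using hK0)]; exact le_top
  apply ENNReal.le_of_forall_pos_le_add
  intro ε hε _
  have hε' : (0:ℝ) < ε := hε
  have h0 : 0 ≤ Y.toReal := ENNReal.toReal_nonneg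
  have hpos : 0 < Y.toReal + ε / K := by positivity
  refine (main (Y.toReal + ε / K) hpos ?_).trans (le_of_eq ?_)
  · rw [ENNReal.le_ofReal_iff_toReal_le hY hpos.le]
    have : 0 < ε / K := by positivity
    linarith
  · rw [mul_add, mul_div_cancel₀ _ hK0.ne', ENNReal.ofReal_add (by positivity) hε'.le,
      ENNReal.ofReal_mul hK0.le, ENNReal.ofReal_toReal hY, ENNReal.ofReal_coe_nnreal]

theorem modulusQ_mono {d : ℕ} (Q0 : Set (Euc d)) (k : ℕ) (f : Euc d → ℝ) (p : ℝ) (q : ℝ≥0∞) :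
    Monotone (modulusQ Q0 k f p q) := by
  intro s t hst
  unfold modulusQ
  apply iSup₂_le
  intro h hh
  have hh' : h ∈ {h : Euc d | ‖h‖ ≤ t} := (show ‖h‖ ≤ s from hh).trans hst
  exact le_iSup₂ (f := fun h (_ : h ∈ {h : Euc d | ‖h‖ ≤ t}) =>
                lorentz (volume.restrict {x ∈ Q0 | x + (k : ℝ) • h ∈ Q0})
                  (iterDiff k h f) p q (Set.Ioo 0 1)) h hh'

theorem log_compare {d : ℕ} (hd : 0 < d) {c : ℝ} (hc : 0 < c) (hc1 : c ≤ 1) {t u : ℝ}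
    (ht : t ∈ Ioo (0:ℝ) 1) (hu : c * t ^ (1 / (d : ℝ)) ≤ u) :
    1 - Real.log u ≤ (1 - Real.log c) * (1 - Real.log t) := by
  have hd1 : (1:ℝ) ≤ d := by exact_mod_cast hd
  have ht0 := ht.1
  have hlt : Real.log t < 0 := Real.log_neg ht.1 ht.2
  have hlc : Real.log c ≤ 0 := Real.log_nonpos hc.le hc1
  have h1 : Real.log (c * t ^ (1 / (d : ℝ))) ≤ Real.log u := Real.log_le_log (by positivity) hu
  rw [Real.log_mul hc.ne' (by positivity), Real.log_rpow ht0] at h1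
  have h2 : 1 / (d:ℝ) ≤ 1 := by rw [div_le_one (by linarith)]; exact hd1
  nlinarith

theorem hardy_top {d : ℕ} (hd : 0 < d) {c M σ b C : ℝ} (hc : 0 < c) (hc1 : c ≤ 1) (hM : 1 < M)
    (hb : b < 0) (hC : 0 < C) :
    ∃ C' : ℝ, 0 < C' ∧ ∀ (ω G : ℝ → ℝ≥0∞) (N : ℝ≥0∞),
      (∀ t ∈ Ioo (0:ℝ) 1, ∀ Y : ℝ≥0∞, N ≤ Y →
        (∀ u : ℝ, 0 < u → u ≤ 1 / M → c * t ^ (1 / (d : ℝ)) ≤ u →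
          ω u ≤ Y * ENNReal.ofReal (u ^ σ)) → G t ≤ ENNReal.ofReal C * Y) →
      (⨆ t ∈ Ioo (0:ℝ) 1, ENNReal.ofReal ((1 - Real.log t) ^ b) * G t) ≤ ENNReal.ofReal C' *
        (N + ⨆ t ∈ Ioo (0:ℝ) 1, ENNReal.ofReal (t ^ (-σ) * (1 - Real.log t) ^ b) * ω t) := by
  have hlc : Real.log c ≤ 0 := Real.log_nonpos hc.le hc1
  set κ := 1 - Real.log c with hκ
  have hκ1 : 1 ≤ κ := by linarith
  have hκ0 : 0 < κ := by linarith
  refine ⟨C * κ ^ (-b), by positivity, ?_⟩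
  intro ω G N hG
  set Z := ⨆ t ∈ Ioo (0:ℝ) 1, ENNReal.ofReal (t ^ (-σ) * (1 - Real.log t) ^ b) * ω t with hZ
  apply iSup₂_le
  intro t ht
  have hlt : Real.log t < 0 := Real.log_neg ht.1 ht.2
  have hA0 : 0 < 1 - Real.log t := by linarith
  have hA1 : 1 ≤ (1 - Real.log t) ^ (-b) := Real.one_le_rpow (by linarith) (by linarith)
  have hB1 : 1 ≤ κ ^ (-b) := Real.one_le_rpow hκ1 (by linarith)
  have h := hG t ht (ENNReal.ofReal (κ ^ (-b) * (1 - Real.log t) ^ (-b)) * (N + Z)) ?_ ?_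
  · calc ENNReal.ofReal ((1 - Real.log t) ^ b) * G t
        ≤ ENNReal.ofReal ((1 - Real.log t) ^ b) * (ENNReal.ofReal C *
          (ENNReal.ofReal (κ ^ (-b) * (1 - Real.log t) ^ (-b)) * (N + Z))) := by gcongr
      _ = _ := by
        rw [← mul_assoc, ← mul_assoc, ← ENNReal.ofReal_mul (by positivity),
          ← ENNReal.ofReal_mul (by positivity)]
        congr 2
        have : (1 - Real.log t) ^ b * (1 - Real.log t) ^ (-b) = 1 := by
          rw [← Real.rpow_add hA0]; simp
        calc _ = ((1 - Real.log t) ^ b * (1 - Real.log t) ^ (-b)) * (C * κ ^ (-b)) := by ring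
          _ = _ := by rw [this, one_mul]
  · calc N ≤ 1 * (N + Z) := by rw [one_mul]; exact le_self_add
      _ ≤ _ := by
        gcongr
        rw [← ENNReal.ofReal_one]
        apply ENNReal.ofReal_le_ofReal
        nlinarith
  · intro u hu0 huM hu
    have hu1 : u < 1 := huM.trans_lt (by rw [div_lt_one (by linarith)]; exact hM)
    have hlu : Real.log u < 0 := Real.log_neg hu0 hu1
    have hU0 : 0 < 1 - Real.log u := by linarith
    have h1 : ENNReal.ofReal (u ^ (-σ) * (1 - Real.log u) ^ b) * ω u ≤ Z :=
      le_iSup₂ (f := fun t (_ : t ∈ Ioo (0:ℝ) 1) =>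
        ENNReal.ofReal (t ^ (-σ) * (1 - Real.log t) ^ b) * ω t) u ⟨hu0, hu1⟩
    have h2 := log_compare hd hc hc1 ht hu
    have h3 : (1 - Real.log u) ^ (-b) ≤ κ ^ (-b) * (1 - Real.log t) ^ (-b) := by
      rw [← Real.mul_rpow hκ0.le hA0.le]
      exact Real.rpow_le_rpow hU0.le h2 (by linarith)
    have h4 : ω u = ENNReal.ofReal (u ^ σ * (1 - Real.log u) ^ (-b)) *
        (ENNReal.ofReal (u ^ (-σ) * (1 - Real.log u) ^ b) * ω u) := by
      rw [← mul_assoc, ← ENNReal.ofReal_mul (by positivity)]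
      have e1 : u ^ σ * u ^ (-σ) = 1 := by rw [← Real.rpow_add hu0]; simp
      have e2 : (1 - Real.log u) ^ (-b) * (1 - Real.log u) ^ b = 1 := by rw [← Real.rpow_add hU0]; simp
      rw [show u ^ σ * (1 - Real.log u) ^ (-b) * (u ^ (-σ) * (1 - Real.log u) ^ b) =
        (u ^ σ * u ^ (-σ)) * ((1 - Real.log u) ^ (-b) * (1 - Real.log u) ^ b) by ring, e1, e2]
      simp
    rw [h4]
    calc _ ≤ ENNReal.ofReal (u ^ σ * (κ ^ (-b) * (1 - Real.log t) ^ (-b))) * (N + Z) := by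
          gcongr
          exact h1.trans le_add_self
      _ = _ := by
          rw [ENNReal.ofReal_mul (by positivity)]; ring

theorem log_integral {β : ℝ} (hβ : 1 < β) {T : ℝ} (hT : 0 < T) (hT1 : T ≤ 1) :
    ∫⁻ t in Ioo (0:ℝ) T, ENNReal.ofReal ((1 - Real.log t) ^ (-β)) / ENNReal.ofReal t ≤
      ENNReal.ofReal ((1 - Real.log T) ^ (1 - β) / (β - 1)) := by
  have hβ1 : 0 < β - 1 := by linarith
  set G : ℝ → ℝ := fun t => if t ≤ 0 then 0 else (1 - Real.log t) ^ (1 - β) / (β - 1) with hG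
  have hpos : ∀ t ∈ Ioo (0:ℝ) T, 0 < 1 - Real.log t := fun t ht => by
    have := Real.log_neg ht.1 (ht.2.trans_le hT1); linarith
  have hder0 : ∀ t, 0 < t → t ≤ 1 → HasDerivAt G ((1 - Real.log t) ^ (-β) / t) t := by
    intro t ht0 ht1
    have hp : 0 < 1 - Real.log t := by
      have := Real.log_nonpos ht0.le ht1; linarith
    have h1 : HasDerivAt (fun t => 1 - Real.log t) (-t⁻¹) t := by
      simpa using (Real.hasDerivAt_log ht0.ne').const_sub 1
    have h2 := (h1.rpow_const (p := 1 - β) (Or.inl hp.ne')).div_const (β - 1)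
    have h3 : G =ᶠ[nhds t] fun t => (1 - Real.log t) ^ (1 - β) / (β - 1) := by
      filter_upwards [lt_mem_nhds ht0] with x hx
      simp only [hG]; rw [if_neg (not_le.2 hx)]
    refine (h2.congr_of_eventuallyEq h3).congr_deriv ?_
    rw [show 1 - β - 1 = -β by ring]
    field_simp
    ring
  have hcont : ContinuousOn G (Icc 0 T) := by
    intro t ht
    rcases ht.1.eq_or_lt with h0 | h0
    · rw [← h0]
      have : ContinuousWithinAt G (Ioi 0) 0 := by
        have hG0 : G 0 = 0 := by simp [hG]
        unfold ContinuousWithinAt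
        rw [hG0]
        have t1 : Tendsto (fun t => 1 - Real.log t) (nhdsWithin 0 (Ioi 0)) atTop := by
          have := tendsto_neg_atBot_atTop.comp Real.tendsto_log_nhdsGT_zero
          have := tendsto_atTop_add_const_left _ (1:ℝ) this
          simpa [sub_eq_add_neg] using this
        have t2 := ((tendsto_rpow_neg_atTop hβ1).comp t1).div_const (β - 1)
        rw [zero_div] at t2
        refine t2.congr' ?_
        filter_upwards [self_mem_nhdsWithin] with x hx
        simp only [hG, Function.comp]
        rw [if_neg (not_le.2 hx), neg_sub]
      exact (continuousWithinAt_Ioi_iff_Ici.1 this).mono Icc_subset_Ici_self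
    · exact (hder0 t h0 (ht.2.trans hT1)).continuousAt.continuousWithinAt
  have hder : ∀ t ∈ Ioo (0:ℝ) T, HasDerivAt G ((1 - Real.log t) ^ (-β) / t) t := fun t ht =>
    hder0 t ht.1 (ht.2.le.trans hT1)
  have hnn : ∀ t ∈ Ioo (0:ℝ) T, 0 ≤ (1 - Real.log t) ^ (-β) / t := fun t ht => by
    have := hpos t ht
    have := ht.1
    positivity
  have hint : IntegrableOn (fun t => (1 - Real.log t) ^ (-β) / t) (Ioc 0 T) :=
    intervalIntegral.integrableOn_deriv_of_nonneg hcont hder hnn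
  have hval := intervalIntegral.integral_eq_sub_of_hasDerivAt_of_le hT.le hcont hder
    ((intervalIntegrable_iff_integrableOn_Ioc_of_le hT.le).2 hint)
  rw [intervalIntegral.integral_of_le hT.le, integral_Ioc_eq_integral_Ioo] at hval
  have hint' := hint.mono_set Ioo_subset_Ioc_self
  have e : ∫⁻ t in Ioo (0:ℝ) T, ENNReal.ofReal ((1 - Real.log t) ^ (-β)) / ENNReal.ofReal t =
      ∫⁻ t in Ioo (0:ℝ) T, ENNReal.ofReal ((1 - Real.log t) ^ (-β) / t) := by
    apply setLIntegral_congr_fun measurableSet_Ioo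
    intro t ht
    exact (ENNReal.ofReal_div_of_pos ht.1).symm
  rw [e, ← ofReal_integral_eq_lintegral_ofReal hint' ?_, hval]
  · apply le_of_eq
    simp only [hG]
    rw [if_neg (not_le.2 hT)]
    simp
  · filter_upwards [self_mem_ae_restrict measurableSet_Ioo] with t ht
    exact hnn t ht

theorem inner_bound {d : ℕ} (hd : 0 < d) {c β : ℝ} (hc : 0 < c) (hc1 : c ≤ 1) (hβ : 1 < β) {s : ℝ}
    (hs : s ∈ Ioo (0:ℝ) 1) :
    ∫⁻ t in Ioo (0:ℝ) 1, (if c * t ^ (1 / (d : ℝ)) < s then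
      ENNReal.ofReal ((1 - Real.log t) ^ (-β)) / ENNReal.ofReal t else 0) ≤
      ENNReal.ofReal ((1 - Real.log c) ^ (β - 1) / (β - 1) * (1 - Real.log s) ^ (1 - β)) := by
  have hd1 : (1:ℝ) ≤ d := by exact_mod_cast hd
  have hs0 := hs.1
  have hβ1 : 0 < β - 1 := by linarith
  have hlc : Real.log c ≤ 0 := Real.log_nonpos hc.le hc1
  have hls : Real.log s < 0 := Real.log_neg hs.1 hs.2
  set T := min 1 ((s / c) ^ d) with hT
  have hT0 : 0 < T := lt_min one_pos (by positivity)
  have hT1 : T ≤ 1 := min_le_left _ _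
  have h1 : ∫⁻ t in Ioo (0:ℝ) 1, (if c * t ^ (1 / (d : ℝ)) < s then
      ENNReal.ofReal ((1 - Real.log t) ^ (-β)) / ENNReal.ofReal t else 0) ≤
      ∫⁻ t in Ioo (0:ℝ) T, ENNReal.ofReal ((1 - Real.log t) ^ (-β)) / ENNReal.ofReal t := by
    rw [← lintegral_indicator measurableSet_Ioo, ← lintegral_indicator measurableSet_Ioo]
    apply lintegral_mono
    intro t
    by_cases ht : t ∈ Ioo (0:ℝ) 1
    · simp only [indicator_of_mem ht]
      split_ifs with hct
      · have ht0 := ht.1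
        have : t ∈ Ioo 0 T := by
          refine ⟨ht.1, lt_min ht.2 ?_⟩
          have h2 : t ^ (1 / (d : ℝ)) < s / c := by
            rw [lt_div_iff₀ hc]; linarith
          have h3 := pow_lt_pow_left₀ h2 (by positivity) hd.ne'
          rwa [one_div, Real.rpow_inv_natCast_pow ht0.le hd.ne'] at h3
        rw [indicator_of_mem this]
      · exact zero_le
    · rw [indicator_of_notMem ht]; exact zero_le
  refine h1.trans ((log_integral hβ hT0 hT1).trans (ENNReal.ofReal_le_ofReal ?_))
  have key : (1 - Real.log s) / (1 - Real.log c) ≤ 1 - Real.log T := by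
    rw [div_le_iff₀ (by linarith)]
    rcases le_total c s with hcs | hcs
    · have : T = 1 := by
        rw [hT]; apply min_eq_left
        apply one_le_pow₀
        rw [le_div_iff₀ hc]; linarith
      rw [this, Real.log_one]
      have := Real.log_le_log hc hcs
      linarith
    · have : T = (s / c) ^ d := by
        rw [hT]; apply min_eq_right
        apply pow_le_one₀ (by positivity)
        rw [div_le_iff₀ hc]; linarith
      rw [this, Real.log_pow, Real.log_div hs0.ne' hc.ne']
      have h3 := Real.log_le_log hs0 hcs
      have h4 : Real.log c - Real.log s ≤ d * (Real.log c - Real.log s) := by nlinarith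
      have h5 : 1 + (Real.log c - Real.log s) ≤ 1 - d * (Real.log s - Real.log c) := by linarith
      nlinarith
  have hq : 0 < (1 - Real.log s) / (1 - Real.log c) := div_pos (by linarith) (by linarith)
  have h2 := Real.rpow_le_rpow_of_nonpos hq key (show 1 - β ≤ 0 by linarith)
  rw [Real.div_rpow (by linarith) (by linarith), div_eq_mul_inv, ← Real.rpow_neg (by linarith), neg_sub] at h2
  calc (1 - Real.log T) ^ (1 - β) / (β - 1)
      ≤ ((1 - Real.log s) ^ (1 - β) * (1 - Real.log c) ^ (β - 1)) / (β - 1) := by gcongr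
    _ = _ := by ring

theorem add_rpow_le_two {R : ℝ} (hR : 0 < R) (x y : ℝ≥0∞) :
    (x + y) ^ R ≤ ENNReal.ofReal (2 ^ R) * (x ^ R + y ^ R) := by
  rw [← ENNReal.ofReal_rpow_of_pos (by norm_num), ENNReal.ofReal_ofNat]
  rcases le_total x y with h | h
  · calc (x + y) ^ R ≤ (2 * y) ^ R := by rw [two_mul]; gcongr
      _ = 2 ^ R * y ^ R := ENNReal.mul_rpow_of_nonneg _ _ hR.le
      _ ≤ _ := by gcongr; exact le_add_self
  · calc (x + y) ^ R ≤ (2 * x) ^ R := by rw [two_mul]; gcongr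
      _ = 2 ^ R * x ^ R := ENNReal.mul_rpow_of_nonneg _ _ hR.le
      _ ≤ _ := by gcongr; exact le_self_add

/-- Local averaging bound for a monotone modulus. -/
theorem phi_bound {M σ R : ℝ} (hM : 1 < M) (hσ : 0 < σ) (hR : 0 < R) {ω : ℝ → ℝ≥0∞} (hω : Monotone ω)
    {u : ℝ} (hu : 0 < u) :
    (ENNReal.ofReal (u ^ (-σ)) * ω u) ^ R ≤ ENNReal.ofReal (M ^ (σ * R) * (M / (M - 1))) *
      ∫⁻ s in Ioo u (M * u), (ENNReal.ofReal (s ^ (-σ)) * ω s) ^ R / ENNReal.ofReal s := by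
  have hM0 : 0 < M := by linarith
  have hM1 : 0 < M - 1 := by linarith
  have h1 : (ENNReal.ofReal ((M * u) ^ (-σ)) * ω u) ^ R / ENNReal.ofReal (M * u) *
      ENNReal.ofReal ((M - 1) * u) ≤
      ∫⁻ s in Ioo u (M * u), (ENNReal.ofReal (s ^ (-σ)) * ω s) ^ R / ENNReal.ofReal s := by
    rw [show (M - 1) * u = M * u - u by ring, ← Real.volume_Ioo, ← setLIntegral_const]
    apply setLIntegral_mono' measurableSet_Ioo
    intro s hs
    have hs1 := hs.1
    have hs2 := hs.2
    have hs0 : 0 < s := hu.trans hs1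
    have ha : (M * u) ^ (-σ) ≤ s ^ (-σ) := Real.rpow_le_rpow_of_nonpos hs0 hs2.le (by linarith)
    have hb : ω u ≤ ω s := hω hs1.le
    have hab : ENNReal.ofReal ((M * u) ^ (-σ)) * ω u ≤ ENNReal.ofReal (s ^ (-σ)) * ω s := by gcongr
    gcongr
  refine le_trans (le_of_eq ?_) (mul_le_mul' le_rfl h1)
  have e1 : (ENNReal.ofReal ((M * u) ^ (-σ)) * ω u) ^ R =
      ENNReal.ofReal (M ^ (-(σ * R))) * (ENNReal.ofReal (u ^ (-σ)) * ω u) ^ R := by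
    rw [Real.mul_rpow hM0.le hu.le, ENNReal.ofReal_mul (by positivity), mul_assoc,
      ENNReal.mul_rpow_of_nonneg _ _ hR.le, ENNReal.ofReal_rpow_of_pos (by positivity),
      ← Real.rpow_mul hM0.le, neg_mul]
  rw [e1, div_eq_mul_inv (_ * _) (ENNReal.ofReal (M * u)), ← ENNReal.ofReal_inv_of_pos (by positivity)]
  set P := (ENNReal.ofReal (u ^ (-σ)) * ω u) ^ R
  have e2 : ENNReal.ofReal (M ^ (σ * R) * (M / (M - 1))) * (ENNReal.ofReal (M ^ (-(σ * R))) * P *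
      ENNReal.ofReal ((M * u)⁻¹) * ENNReal.ofReal ((M - 1) * u)) =
      ENNReal.ofReal (M ^ (σ * R) * (M / (M - 1)) * M ^ (-(σ * R)) * (M * u)⁻¹ * ((M - 1) * u)) * P := by
    rw [ENNReal.ofReal_mul (p := M ^ (σ * R) * (M / (M - 1)) * M ^ (-(σ * R)) * (M * u)⁻¹) (by positivity),
      ENNReal.ofReal_mul (p := M ^ (σ * R) * (M / (M - 1)) * M ^ (-(σ * R))) (by positivity),
      ENNReal.ofReal_mul (p := M ^ (σ * R) * (M / (M - 1))) (by positivity)]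
    ring
  rw [e2]
  have e3 : M ^ (σ * R) * M ^ (-(σ * R)) = 1 := by rw [← Real.rpow_add hM0]; simp
  have e4 : M ^ (σ * R) * (M / (M - 1)) * M ^ (-(σ * R)) * (M * u)⁻¹ * ((M - 1) * u) = 1 := by
    calc _ = (M ^ (σ * R) * M ^ (-(σ * R))) * ((M / (M - 1)) * (M * u)⁻¹ * ((M - 1) * u)) := by ring
      _ = _ := by rw [e3]; field_simp
  rw [e4]; simp

theorem hardy_fin {d : ℕ} (hd : 0 < d) {c M σ b C R ξ : ℝ} (hc : 0 < c) (hc1 : c ≤ 1) (hM : 1 < M)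
    (hσ : 0 < σ) (hR : 0 < R) (hb : b * R < -1) (hξ : ξ * R = b * R + 1) (hC : 0 < C) :
    ∃ C' : ℝ, 0 < C' ∧ ∀ (ω G : ℝ → ℝ≥0∞) (N : ℝ≥0∞), Monotone ω →
      (∀ t ∈ Ioo (0:ℝ) 1, ∀ Y : ℝ≥0∞, N ≤ Y →
        (∀ u : ℝ, 0 < u → u ≤ 1 / M → c * t ^ (1 / (d : ℝ)) ≤ u →
          ω u ≤ Y * ENNReal.ofReal (u ^ σ)) → G t ≤ ENNReal.ofReal C * Y) →
      (∫⁻ t in Ioo (0:ℝ) 1, (ENNReal.ofReal ((1 - Real.log t) ^ b) * G t) ^ R / ENNReal.ofReal t) ^ (1 / R)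
        ≤ ENNReal.ofReal C' *
        (N + (∫⁻ t in Ioo (0:ℝ) 1,
          (ENNReal.ofReal (t ^ (-σ) * (1 - Real.log t) ^ ξ) * ω t) ^ R / ENNReal.ofReal t) ^ (1 / R)) := by
  have hM0 : 0 < M := by linarith
  have hM1 : 0 < M - 1 := by linarith
  have hlc : Real.log c ≤ 0 := Real.log_nonpos hc.le hc1
  set β := -(b * R) with hβ
  have hβ1 : 1 < β := by linarith
  have hβ0 : 0 < β - 1 := by linarith
  set K := M ^ (σ * R) * (M / (M - 1)) with hK
  have hK0 : 0 < K := by positivity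
  set κ := (1 - Real.log c) ^ (β - 1) / (β - 1) with hκ
  have hκ0 : 0 < κ := by
    have : 0 < 1 - Real.log c := by linarith
    positivity
  set B := C ^ R * 2 ^ R with hB
  have hB0 : 0 < B := by positivity
  set E := B * (1 / (β - 1) + K * κ) with hE
  have hE0 : 0 < E := by positivity
  refine ⟨E ^ (1 / R), by positivity, ?_⟩
  intro ω G N hω hG
  set ψ : ℝ → ℝ≥0∞ := fun s => (ENNReal.ofReal (s ^ (-σ)) * ω s) ^ R / ENNReal.ofReal s with hψ
  have hωm : Measurable ω := hω.measurable
  have hψm : Measurable ψ := by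
    simp only [hψ]
    exact ((((measurable_id.pow_const _).ennreal_ofReal).mul hωm).pow_const R).div
      ENNReal.measurable_ofReal
  set w : ℝ → ℝ≥0∞ := fun t => ENNReal.ofReal ((1 - Real.log t) ^ (-β)) / ENNReal.ofReal t with hw
  have hwm : Measurable w := by
    simp only [hw]
    exact (((Real.measurable_log.const_sub 1).pow_const _).ennreal_ofReal).div ENNReal.measurable_ofReal
  set J : ℝ → ℝ≥0∞ := fun t => ∫⁻ s in Ioo (0:ℝ) 1, (if c * t ^ (1 / (d : ℝ)) < s then ψ s else 0) with hJ
  set Z := ∫⁻ t in Ioo (0:ℝ) 1,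
          (ENNReal.ofReal (t ^ (-σ) * (1 - Real.log t) ^ ξ) * ω t) ^ R / ENNReal.ofReal t with hZ
  have hGt : ∀ t ∈ Ioo (0:ℝ) 1, G t ^ R ≤ ENNReal.ofReal B * (N ^ R + ENNReal.ofReal K * J t) := by
    intro t ht
    have ht0 := ht.1
    have h := hG t ht (N + (ENNReal.ofReal K * J t) ^ (1 / R)) le_self_add ?_
    · calc G t ^ R ≤ (ENNReal.ofReal C * (N + (ENNReal.ofReal K * J t) ^ (1 / R))) ^ R := by gcongr
        _ = ENNReal.ofReal (C ^ R) * (N + (ENNReal.ofReal K * J t) ^ (1 / R)) ^ R := by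
          rw [ENNReal.mul_rpow_of_nonneg _ _ hR.le, ENNReal.ofReal_rpow_of_pos hC]
        _ ≤ ENNReal.ofReal (C ^ R) * (ENNReal.ofReal (2 ^ R) *
            (N ^ R + ((ENNReal.ofReal K * J t) ^ (1 / R)) ^ R)) := by
          gcongr; exact add_rpow_le_two hR _ _
        _ = _ := by
          rw [← ENNReal.rpow_mul, one_div_mul_cancel hR.ne', ENNReal.rpow_one, ← mul_assoc,
            ← ENNReal.ofReal_mul (by positivity)]
    · intro u hu0 huM hu
      have h1 : ∫⁻ s in Ioo u (M * u), ψ s ≤ J t := by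
        simp only [hJ]
        calc ∫⁻ s in Ioo u (M * u), ψ s
            ≤ ∫⁻ s in Ioo u (M * u), (if c * t ^ (1 / (d : ℝ)) < s then ψ s else 0) := by
              apply setLIntegral_mono' measurableSet_Ioo
              intro s hs
              rw [if_pos (hu.trans_lt hs.1)]
          _ ≤ _ := by
              apply lintegral_mono_set
              intro s hs
              refine ⟨hu0.trans hs.1, hs.2.trans_le ?_⟩
              rw [le_div_iff₀ hM0] at huM
              linarith
      have h2 := (phi_bound hM hσ hR hω hu0).trans (mul_le_mul' le_rfl h1)
      have h3 : ENNReal.ofReal (u ^ (-σ)) * ω u ≤ (ENNReal.ofReal K * J t) ^ (1 / R) := by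
        have := ENNReal.rpow_le_rpow h2 (show 0 ≤ 1 / R by positivity)
        rwa [← ENNReal.rpow_mul, mul_one_div_cancel hR.ne', ENNReal.rpow_one] at this
      have h4 : ω u = (ENNReal.ofReal (u ^ (-σ)) * ω u) * ENNReal.ofReal (u ^ σ) := by
        rw [mul_right_comm, ← ENNReal.ofReal_mul (by positivity), ← Real.rpow_add hu0]
        simp
      rw [h4]
      gcongr
      exact h3.trans le_add_self
  have hmain : ∫⁻ t in Ioo (0:ℝ) 1, (ENNReal.ofReal ((1 - Real.log t) ^ b) * G t) ^ R / ENNReal.ofReal t ≤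
      ∫⁻ t in Ioo (0:ℝ) 1, ENNReal.ofReal B * (w t * N ^ R + ENNReal.ofReal K * (w t * J t)) := by
    apply setLIntegral_mono' measurableSet_Ioo
    intro t ht
    have hlt : Real.log t < 0 := Real.log_neg ht.1 ht.2
    have hp : 0 < 1 - Real.log t := by linarith
    have e : (ENNReal.ofReal ((1 - Real.log t) ^ b) * G t) ^ R / ENNReal.ofReal t = w t * G t ^ R := by
      rw [ENNReal.mul_rpow_of_nonneg _ _ hR.le, ENNReal.ofReal_rpow_of_pos (by positivity),
        ← Real.rpow_mul hp.le]
      simp only [hw, hβ, neg_neg, div_eq_mul_inv]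
      ring
    rw [e]
    calc w t * G t ^ R ≤ w t * (ENNReal.ofReal B * (N ^ R + ENNReal.ofReal K * J t)) := by
          gcongr; exact hGt t ht
      _ = _ := by ring
  have hw1 : ∫⁻ t in Ioo (0:ℝ) 1, w t ≤ ENNReal.ofReal (1 / (β - 1)) := by
    have := log_integral hβ1 one_pos le_rfl
    simpa using this
  have hset : MeasurableSet {x : ℝ × ℝ | c * x.1 ^ (1 / (d : ℝ)) < x.2} :=
    measurableSet_lt ((measurable_fst.pow_const _).const_mul c) measurable_snd
  have hFm : Measurable (Function.uncurry fun t s : ℝ =>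
      if c * t ^ (1 / (d : ℝ)) < s then w t * ψ s else 0) :=
    Measurable.ite hset ((hwm.comp measurable_fst).mul (hψm.comp measurable_snd)) measurable_const
  have hwJ : ∫⁻ t in Ioo (0:ℝ) 1, w t * J t ≤ ENNReal.ofReal κ * Z := by
    calc ∫⁻ t in Ioo (0:ℝ) 1, w t * J t
        = ∫⁻ t in Ioo (0:ℝ) 1, ∫⁻ s in Ioo (0:ℝ) 1, (if c * t ^ (1 / (d : ℝ)) < s then w t * ψ s else 0) := by
          apply lintegral_congr
          intro t
          simp only [hJ]
          rw [← lintegral_const_mul]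
          · apply lintegral_congr
            intro s
            split_ifs <;> simp
          · exact Measurable.ite (measurableSet_lt measurable_const measurable_id) hψm measurable_const
      _ = ∫⁻ s in Ioo (0:ℝ) 1, ∫⁻ t in Ioo (0:ℝ) 1, (if c * t ^ (1 / (d : ℝ)) < s then w t * ψ s else 0) :=
          lintegral_lintegral_swap hFm.aemeasurable
      _ ≤ ∫⁻ s in Ioo (0:ℝ) 1, ENNReal.ofReal κ *
          ((ENNReal.ofReal (s ^ (-σ) * (1 - Real.log s) ^ ξ) * ω s) ^ R / ENNReal.ofReal s) := by
          apply setLIntegral_mono' measurableSet_Ioo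
          intro s hs
          have hs0 := hs.1
          have hls : Real.log s < 0 := Real.log_neg hs.1 hs.2
          have hp : 0 < 1 - Real.log s := by linarith
          calc ∫⁻ t in Ioo (0:ℝ) 1, (if c * t ^ (1 / (d : ℝ)) < s then w t * ψ s else 0)
              = (∫⁻ t in Ioo (0:ℝ) 1, (if c * t ^ (1 / (d : ℝ)) < s then w t else 0)) * ψ s := by
                rw [← lintegral_mul_const]
                · apply lintegral_congr
                  intro t
                  split_ifs <;> simp
                · exact Measurable.ite (measurableSet_lt ((measurable_id.pow_const _).const_mul c)
                    measurable_const) hwm measurable_const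
            _ ≤ ENNReal.ofReal (κ * (1 - Real.log s) ^ (1 - β)) * ψ s := by
                gcongr
                exact inner_bound hd hc hc1 hβ1 hs
            _ = _ := by
                have e1 : 1 - β = ξ * R := by rw [hξ, hβ]; ring
                rw [ENNReal.ofReal_mul hκ0.le, e1, Real.rpow_mul hp.le,
                  ← ENNReal.ofReal_rpow_of_pos (by positivity), ENNReal.ofReal_mul (by positivity)]
                simp only [hψ, div_eq_mul_inv]
                rw [mul_assoc, ← mul_assoc (ENNReal.ofReal ((1 - Real.log s) ^ ξ) ^ R),
                  ← ENNReal.mul_rpow_of_nonneg _ _ hR.le]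
                congr 3
                ring
      _ = ENNReal.ofReal κ * Z := by
          rw [hZ, lintegral_const_mul]
          exact (((((measurable_id.pow_const _).mul ((Real.measurable_log.const_sub 1).pow_const _)).ennreal_ofReal).mul hωm).pow_const R).div
            ENNReal.measurable_ofReal
  have hJm : Measurable J := by
    simp only [hJ]
    exact Measurable.lintegral_prod_right' (f := fun x : ℝ × ℝ => if c * x.1 ^ (1 / (d : ℝ)) < x.2 then ψ x.2 else 0)
      (Measurable.ite hset (hψm.comp measurable_snd) measurable_const)
  have hfin : ∫⁻ t in Ioo (0:ℝ) 1, (ENNReal.ofReal ((1 - Real.log t) ^ b) * G t) ^ R / ENNReal.ofReal t ≤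
      ENNReal.ofReal E * (N + Z ^ (1 / R)) ^ R := by
    refine hmain.trans ?_
    rw [lintegral_const_mul _ (by fun_prop), lintegral_add_left (by fun_prop), lintegral_mul_const _ hwm,
      lintegral_const_mul _ (by fun_prop)]
    have n1 : N ^ R ≤ (N + Z ^ (1 / R)) ^ R := by gcongr; exact le_self_add
    have n2 : Z ≤ (N + Z ^ (1 / R)) ^ R := by
      calc Z = (Z ^ (1 / R)) ^ R := by
            rw [← ENNReal.rpow_mul, one_div_mul_cancel hR.ne', ENNReal.rpow_one]
        _ ≤ _ := by gcongr; exact le_add_self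
    set P := (N + Z ^ (1 / R)) ^ R
    calc _ ≤ ENNReal.ofReal B * (ENNReal.ofReal (1 / (β - 1)) * P +
          ENNReal.ofReal K * (ENNReal.ofReal κ * P)) := by
          gcongr
          exact hwJ.trans (by gcongr)
      _ = _ := by
          rw [hE, ENNReal.ofReal_mul hB0.le, ENNReal.ofReal_add (by positivity) (by positivity),
            ENNReal.ofReal_mul hK0.le]
          ring
  calc _ ≤ (ENNReal.ofReal E * (N + Z ^ (1 / R)) ^ R) ^ (1 / R) := by gcongr
    _ = _ := by
      rw [ENNReal.mul_rpow_of_nonneg _ _ (by positivity), ENNReal.ofReal_rpow_of_pos hE0,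
        ← ENNReal.rpow_mul, mul_one_div_cancel hR.ne', ENNReal.rpow_one]

/-- The first estimate, for all parameters. -/
theorem main_estimate (d : ℕ) (hd : 0 < d) (Q0 : Set (Euc d)) (hQ0 : IsCube Q0)
    (p : ℝ) (hp : 1 < p) (q r : ℝ≥0∞) (hq : 0 < q) (hr : 0 < r)
    (k : ℕ) (hk : (d : ℝ) / p < (k : ℝ)) (b : ℝ) (hb : b < -((1 / r).toReal)) :
    ∃ C : ℝ, 0 < C ∧ ∀ f : Euc d → ℝ, Measurable f →
      qnorm r (Set.Ioo 0 1)
          (fun t => ENNReal.ofReal ((1 - Real.log t) ^ b) *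
            rearr (volume.restrict Q0) (sharpLocal volume Q0 f) t) ≤
        ENNReal.ofReal C *
          besovQ Q0 k f p q ((d : ℝ) / p) (b + (1 / r).toReal) r := by
  obtain ⟨a, l, hl, rfl⟩ := hQ0
  have hd0 : (0:ℝ) < d := by exact_mod_cast hd
  have hp0 : 0 < p := by linarith
  have hσ : 0 < (d : ℝ) / p := by positivity
  have hk0 : 0 < k := by
    have : (0:ℝ) < k := hσ.trans hk
    exact_mod_cast this
  obtain ⟨C, c, M, hC, hc, hc1, hM, hpt⟩ := pointwise_bound (d := d) hd hl hp hq hk0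
  by_cases hri : r = ∞
  · subst hri
    have hb0 : b < 0 := by simpa using hb
    obtain ⟨C', hC', h⟩ := hardy_top (σ := (d : ℝ) / p) hd hc hc1 hM hb0 hC
    refine ⟨C', hC', ?_⟩
    intro f hf
    have := h (modulusQ (cubeSet a l) k f p q)
      (rearr (volume.restrict (cubeSet a l)) (sharpLocal volume (cubeSet a l) f))
      (lorentz (volume.restrict (cubeSet a l)) f p q (Ioo 0 1))
      (fun t ht Y hN hu => hpt a f t Y hf ht hN hu)
    simpa [qnorm, besovQ] using this
  · set R := r.toReal with hR
    have hR0 : 0 < R := ENNReal.toReal_pos hr.ne' hri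
    have h1r : (1 / r).toReal = 1 / R := by rw [ENNReal.toReal_div, ENNReal.toReal_one]
    rw [h1r] at hb ⊢
    have hbR : b * R < -1 := by
      have := mul_lt_mul_of_pos_right hb hR0
      rwa [neg_mul, one_div_mul_cancel hR0.ne'] at this
    have hξ : (b + 1 / R) * R = b * R + 1 := by field_simp
    obtain ⟨C', hC', h⟩ := hardy_fin hd hc hc1 hM hσ hR0 hbR hξ hC
    refine ⟨C', hC', ?_⟩
    intro f hf
    have := h (modulusQ (cubeSet a l) k f p q)
      (rearr (volume.restrict (cubeSet a l)) (sharpLocal volume (cubeSet a l) f))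
      (lorentz (volume.restrict (cubeSet a l)) f p q (Ioo 0 1))
      (modulusQ_mono _ _ _ _ _)
      (fun t ht Y hN hu => hpt a f t Y hf ht hN hu)
    unfold besovQ qnorm
    rw [if_neg hri, if_neg hri]
    exact this

/-- Calderón–Scott type estimates for limiting Lorentz–Zygmund spaces
(Corollary 2.3). -/
theorem statement13 (d : ℕ) (hd : 0 < d) (Q0 : Set (Euc d)) (hQ0 : IsCube Q0)
    (p : ℝ) (hp : 1 < p) (q r : ℝ≥0∞) (hq : 0 < q) (hr : 0 < r)
    (k : ℕ) (hk : (d : ℝ) / p < (k : ℝ)) (b : ℝ) (hb : b < -((1 / r).toReal)) :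
    (∃ C : ℝ, 0 < C ∧ ∀ f : Euc d → ℝ, Measurable f →
      qnorm r (Set.Ioo 0 1)
          (fun t => ENNReal.ofReal ((1 - Real.log t) ^ b) *
            rearr (volume.restrict Q0) (sharpLocal volume Q0 f) t) ≤
        ENNReal.ofReal C *
          besovQ Q0 k f p q ((d : ℝ) / p) (b + (1 / r).toReal) r) ∧
    (∃ C : ℝ, 0 < C ∧ ∀ f : Euc d → ℝ, Measurable f →
      qnorm r (Set.Ioo 0 1)
          (fun t => ENNReal.ofReal ((1 - Real.log t) ^ b) *
            rearr (volume.restrict Q0) (sharpLocal volume Q0 f) t) ≤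
        ENNReal.ofReal C *
          besovQ Q0 k f p (ENNReal.ofReal p) ((d : ℝ) / p) (b + (1 / r).toReal) r) ∧
    (∀ lam : ℝ, 0 < lam → ∃ C : ℝ, 0 < C ∧ ∀ f : Euc d → ℝ, Measurable f →
      (⨆ t ∈ Set.Ioo (0 : ℝ) 1,
          ENNReal.ofReal ((1 - Real.log t) ^ (-(1 : ℝ) / lam)) *
            rearr (volume.restrict Q0) (sharpLocal volume Q0 f) t) ≤
        ENNReal.ofReal C *
          besovQ Q0 k f p (ENNReal.ofReal p) ((d : ℝ) / p) (-(1 : ℝ) / lam) ∞) := by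
  have hp0 : (0 : ℝ) < p := by linarith
  have hq2 : 0 < ENNReal.ofReal p := ENNReal.ofReal_pos.2 hp0
  refine ⟨main_estimate d hd Q0 hQ0 p hp q r hq hr k hk b hb,
    main_estimate d hd Q0 hQ0 p hp (ENNReal.ofReal p) r hq2 hr k hk b hb, ?_⟩
  intro lam hlam
  have hneg : -(1 : ℝ) / lam < -((1 / (∞ : ℝ≥0∞)).toReal) := by
    have h1 : 0 < 1 / lam := by positivity
    rw [neg_div]
    simpa using h1
  obtain ⟨C, hC, h⟩ := main_estimate d hd Q0 hQ0 p hp (ENNReal.ofReal p) ∞ hq2 (by simp) k hk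
    (-(1 : ℝ) / lam) hneg
  refine ⟨C, hC, fun f hf => ?_⟩
  have h2 := h f hf
  have e : -(1 : ℝ) / lam + (1 / (∞ : ℝ≥0∞)).toReal = -(1 : ℝ) / lam := by simp
  rw [e] at h2
  unfold qnorm at h2
  rw [if_pos rfl] at h2
  exact h2

end
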